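/- arXiv:1309.5462 — 6 statements merged into one kernel-verified Lean document; each statement's English description precedes it below -/
import Mathlib

section
/- There exists a mean-payoff game with partial-observation G such that Eve has a winning observation-based strategy in G, but no observation-based strategy of Eve with finite memory is winning in G. -/
open Classical

/-- A mean-payoff game (MPG) with partial-observation. -/
structure MPG where
  Q : Type
  A : Type
  fintypeQ : Fintype Q
  decEqQ : DecidableEq Q
  fintypeA : Fintype A
  nonemptyA : Nonempty A
  qI : Q
  delta : Q → A → Q → Prop
  total : ∀ q a, ∃ q', delta q a q'
  w : Q → A → Q → ℤ
  Obs : Set (Set Q)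
  partition : Setoid.IsPartition Obs

namespace MPG

variable (G : MPG)

/-- `post_σ(o)`. -/
def post (o : Set G.Q) (a : G.A) : Set G.Q :=
  {q' | ∃ q ∈ o, G.delta q a q'}

/-- Limited-observation condition. -/
def LimitedObs : Prop :=
  ({G.qI} : Set G.Q) ∈ G.Obs ∧
    ∀ o ∈ G.Obs, ∀ a : G.A, ∃ S ⊆ G.Obs, G.post o a = ⋃₀ S

/-- Infinite concrete paths, as sequences of state-action pairs. -/
def IsConcretePath (π : ℕ → G.Q × G.A) : Prop :=
  ∀ i, G.delta (π i).1 (π i).2 (π (i + 1)).1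

/-- weight of the first `n` transitions of a concrete path -/
def sumW (π : ℕ → G.Q × G.A) (n : ℕ) : ℤ :=
  ∑ i ∈ Finset.range n, G.w (π i).1 (π i).2 (π (i + 1)).1

/-- Mean payoff (`liminf`). -/
noncomputable def MP (π : ℕ → G.Q × G.A) : ℝ :=
  Filter.liminf (fun n => (G.sumW π n : ℝ) / (n : ℝ)) Filter.atTop

/-- Infinite abstract paths, as sequences of observation-action pairs. -/
def IsAbstractPath (ψ : ℕ → Set G.Q × G.A) : Prop :=
  (∀ i, (ψ i).1 ∈ G.Obs) ∧
    ∀ i, ∃ q ∈ (ψ i).1, ∃ q' ∈ (ψ (i + 1)).1, G.delta q (ψ i).2 q'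

/-- `γ(ψ)`: concrete paths compatible with an abstract path. -/
def gamma (ψ : ℕ → Set G.Q × G.A) : Set (ℕ → G.Q × G.A) :=
  {π | G.IsConcretePath π ∧ ∀ i, (π i).1 ∈ (ψ i).1 ∧ (π i).2 = (ψ i).2}

/-- A play: an infinite abstract path starting at the observation containing `qI`. -/
def IsPlay (ψ : ℕ → Set G.Q × G.A) : Prop :=
  G.IsAbstractPath ψ ∧ G.qI ∈ (ψ 0).1

def WinningForEve (ψ : ℕ → Set G.Q × G.A) : Prop :=
  ∀ π ∈ G.gamma ψ, 0 ≤ G.MP π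

def WinningForAdam (ψ : ℕ → Set G.Q × G.A) : Prop :=
  ∃ π ∈ G.gamma ψ, G.MP π < 0

/-- the prefix `o₀σ₀…o_{i-1}σ_{i-1}` of a play -/
def hist (ψ : ℕ → Set G.Q × G.A) (i : ℕ) : List (Set G.Q × G.A) :=
  (List.range i).map ψ

/-- An observation-based strategy for Eve: from a play prefix
`o₀σ₀…o_{n-1}σ_{n-1}` together with the current observation `o_n`, choose an action. -/
def EveStrategy : Type :=
  List (Set G.Q × G.A) → Set G.Q → G.A

def ConsistentE (st : G.EveStrategy) (ψ : ℕ → Set G.Q × G.A) : Prop :=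
  ∀ i, (ψ i).2 = st (G.hist ψ i) (ψ i).1

def EveWinningStrategy (st : G.EveStrategy) : Prop :=
  ∀ ψ, G.IsPlay ψ → G.ConsistentE st ψ → G.WinningForEve ψ

/-- Eve's strategy `st` has memory `m`. -/
def HasMemory (st : G.EveStrategy) (m : ℕ) : Prop :=
  ∃ (M : Type) (inst : Fintype M) (m0 : M)
    (αu : M → Set G.Q → M) (αo : M → Set G.Q → G.A),
    @Fintype.card M inst = m ∧
      ∀ ψ : ℕ → Set G.Q × G.A, G.IsPlay ψ → ∀ i,
        st (G.hist ψ i) (ψ i).1 =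
          αo ((G.hist ψ i).foldl (fun x p => αu x p.1) m0) (ψ i).1

def FiniteMemory (st : G.EveStrategy) : Prop :=
  ∃ m, G.HasMemory st m

/-- An observation-based strategy for Adam. -/
def AdamStrategy : Type :=
  List (Set G.Q × G.A) → Set G.Q → G.A → Set G.Q

def AdamStrategyValid (st : G.AdamStrategy) : Prop :=
  ∀ ψ : ℕ → Set G.Q × G.A, G.IsPlay ψ → ∀ i, ∀ a : G.A,
    st (G.hist ψ i) (ψ i).1 a ∈ G.Obs ∧
      (st (G.hist ψ i) (ψ i).1 a ∩ G.post (ψ i).1 a).Nonempty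

def ConsistentA (st : G.AdamStrategy) (ψ : ℕ → Set G.Q × G.A) : Prop :=
  ∀ i, (ψ (i + 1)).1 = st (G.hist ψ i) (ψ i).1 (ψ i).2

def AdamWinningStrategy (st : G.AdamStrategy) : Prop :=
  G.AdamStrategyValid st ∧
    ∀ ψ, G.IsPlay ψ → G.ConsistentA st ψ → G.WinningForAdam ψ

/-- Adam's strategy `st` has memory `m`. -/
def AdamHasMemory (st : G.AdamStrategy) (m : ℕ) : Prop :=
  ∃ (M : Type) (inst : Fintype M) (m0 : M)
    (αu : M → Set G.Q → G.A → M) (αo : M → Set G.Q → G.A → Set G.Q),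
    @Fintype.card M inst = m ∧
      ∀ ψ : ℕ → Set G.Q × G.A, G.IsPlay ψ → ∀ i, ∀ a : G.A,
        st (G.hist ψ i) (ψ i).1 a =
          αo ((G.hist ψ i).foldl (fun x p => αu x p.1 p.2) m0) (ψ i).1 a

/-- The set `F` of functions `Q → ℤ ∪ {+∞, ⊥}`; `none` plays the role of `⊥`
and `some ⊤` the role of `+∞`. -/
abbrev FF : Type := G.Q → Option (WithTop ℤ)

def Fsupp (f : G.FF) : Set G.Q := {q | f q ≠ none}

/-- The candidate values `f(q') + w(q',σ,q)` used in the definition of a σ-successor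
(with the convention `+∞ + k = +∞`). -/
def transVals (f : G.FF) (a : G.A) (q : G.Q) : Set (WithTop ℤ) :=
  {x | ∃ q' v, f q' = some v ∧ G.delta q' a q ∧ x = v + (G.w q' a q : WithTop ℤ)}

def IsMinOf (m : WithTop ℤ) (s : Set (WithTop ℤ)) : Prop :=
  m ∈ s ∧ ∀ x ∈ s, m ≤ x

/-- `f'` is a σ-successor of `f`. -/
def IsSucc (f : G.FF) (a : G.A) (f' : G.FF) : Prop :=
  G.Fsupp f' ∈ G.Obs ∧ G.Fsupp f' ⊆ G.post (G.Fsupp f) a ∧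
    ∀ q ∈ G.Fsupp f', f' q = some ⊤ ∨
      ∃ m, f' q = some m ∧ IsMinOf m (G.transVals f a q)

/-- `f'` is a proper σ-successor of `f`. -/
def IsProperSucc (f : G.FF) (a : G.A) (f' : G.FF) : Prop :=
  G.IsSucc f a f' ∧
    ∀ q ∈ G.Fsupp f', ∃ m, f' q = some m ∧ IsMinOf m (G.transVals f a q)

/-- the order `f ⪯ₖ f'`. -/
def prec (k : ℕ) (f f' : G.FF) : Prop :=
  G.Fsupp f = G.Fsupp f' ∧
    ∀ q ∈ G.Fsupp f, ∃ v v', f q = some v ∧ f' q = some v' ∧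
      v + ((k : ℤ) : WithTop ℤ) ≤ v'

/-- positions of the reachability game associated with `G`: the sequence
`f₀σ₀f₁…σ_{n-1}fₙ` is represented by the list `[(f₀,σ₀),…,(f_{n-1},σ_{n-1})]`
together with the final function `fₙ`. -/
abbrev Pos : Type := List (G.FF × G.A) × G.FF

def fI : G.FF := fun q =>
  letI := G.decEqQ
  if q = G.qI then some ((0 : ℤ) : WithTop ℤ) else none

def initPos : G.Pos := ([], G.fI)

/-- the `i`-th function of a position (the final one for `i ≥ length`). -/
def posFun (p : G.Pos) (i : ℕ) : G.FF :=
  if h : i < p.1.length then (p.1.get ⟨i, h⟩).1 else p.2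

/-- membership in `Π_G`. -/
def ValidPos (p : G.Pos) : Prop :=
  G.posFun p 0 = G.fI ∧
    (∀ i (hi : i < p.1.length),
      G.IsSucc (G.posFun p i) (p.1.get ⟨i, hi⟩).2 (G.posFun p (i + 1))) ∧
    ∀ i j, i < j → j < p.1.length →
      ¬ G.prec 0 (G.posFun p i) (G.posFun p j) ∧
        ¬ G.prec 1 (G.posFun p j) (G.posFun p i)

/-- membership in `T_E`. -/
def inTE (p : G.Pos) : Prop :=
  ∃ i < p.1.length, G.prec 0 (G.posFun p i) p.2

/-- membership in `T_A`. -/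
def inTA (p : G.Pos) : Prop :=
  ∃ i < p.1.length, G.prec 1 p.2 (G.posFun p i) ∧
    ∃ q ∈ G.Fsupp (G.posFun p i), G.posFun p i q ≠ some ⊤

def TerminalPos (p : G.Pos) : Prop := G.inTE p ∨ G.inTA p

def extend (p : G.Pos) (a : G.A) (f : G.FF) : G.Pos :=
  (p.1 ++ [(p.2, a)], f)

/-- One step of the reachability game (with validity predicate `V`), consistent with
Eve's strategy `sE`: at a terminal position the play stops (stutters); otherwise Eve
plays `sE p` and Adam picks any successor giving a valid position (if there is none,
the play stutters). -/
def EveNext (V : G.Pos → Prop) (sE : G.Pos → G.A) (p p' : G.Pos) : Prop :=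
  (G.TerminalPos p → p' = p) ∧
    (¬ G.TerminalPos p →
      (∃ f, p' = G.extend p (sE p) f ∧ V p') ∨
        ((¬ ∃ f, V (G.extend p (sE p) f)) ∧ p' = p))

/-- Eve wins the reachability game with positions `V` using strategy `sE`. -/
def EveWinningR (V : G.Pos → Prop) (sE : G.Pos → G.A) : Prop :=
  ∀ ps : ℕ → G.Pos, ps 0 = G.initPos →
    (∀ k, G.EveNext V sE (ps k) (ps (k + 1))) → ∃ k, G.inTE (ps k)

/-- One step of the reachability game, consistent with Adam's strategy `sA`. -/
def AdamNext (V : G.Pos → Prop) (sA : G.Pos → G.A → G.FF) (p p' : G.Pos) : Prop :=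
  (G.TerminalPos p → p' = p) ∧
    (¬ G.TerminalPos p → ∃ a : G.A,
      (V (G.extend p a (sA p a)) ∧ p' = G.extend p a (sA p a)) ∨
        ((¬ ∃ f, V (G.extend p a f)) ∧ p' = p))

/-- Adam wins the reachability game with positions `V` using strategy `sA`. -/
def AdamWinningR (V : G.Pos → Prop) (sA : G.Pos → G.A → G.FF) : Prop :=
  ∀ ps : ℕ → G.Pos, ps 0 = G.initPos →
    (∀ k, G.AdamNext V sA (ps k) (ps (k + 1))) → ∃ k, G.inTA (ps k)

/-- `G` is forcibly terminating: some player wins `Γ_G`. -/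
def ForciblyTerminating : Prop :=
  (∃ sE, G.EveWinningR G.ValidPos sE) ∨ (∃ sA, G.AdamWinningR G.ValidPos sA)

/-- membership in `Π'_G`: positions of `Γ'_G` (pairwise distinct supports). -/
def ValidPos' (p : G.Pos) : Prop :=
  G.ValidPos p ∧ ∀ i j, i < j → j < p.1.length →
    G.Fsupp (G.posFun p i) ≠ G.Fsupp (G.posFun p j)

/-- `G` is forcibly FAC: some player wins `Γ'_G`. -/
def ForciblyFAC : Prop :=
  (∃ sE, G.EveWinningR G.ValidPos' sE) ∨ (∃ sA, G.AdamWinningR G.ValidPos' sA)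

/-- `G` is FAC: every leaf of `Γ'_G` is terminal. -/
def FAC : Prop :=
  ∀ p, G.ValidPos' p → (¬ ∃ a f, G.ValidPos' (G.extend p a f)) →
    G.inTE p ∨ G.inTA p

end MPG

namespace MPG

open Filter Topology

/-- A blind game whose winning plays are those where the action `true` occurs infinitely often
but with density zero. State `0` charges Eve for each `true`; at any time Adam may move to
state `1`, which charges for each `false` until the next `true`, and then to the free sink `2`. -/
@[reducible]
def sparseGame : MPG where
  Q := Fin 3
  A := Bool
  fintypeQ := inferInstance
  decEqQ := inferInstance
  fintypeA := inferInstance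
  nonemptyA := inferInstance
  qI := 0
  delta q a q' :=
    (q = 0 ∧ q' ≠ 2) ∨ (q = 1 ∧ a = false ∧ q' = 1) ∨ (q = 1 ∧ a = true ∧ q' = 2) ∨
      (q = 2 ∧ q' = 2)
  total q a := by
    fin_cases q
    · exact ⟨0, by simp⟩
    · cases a
      · exact ⟨1, by simp⟩
      · exact ⟨2, by simp⟩
    · exact ⟨2, by simp⟩
  w q a _ := if (q = 0 ∧ a = true) ∨ (q = 1 ∧ a = false) then -1 else 0
  Obs := {Set.univ}
  partition := by
    refine ⟨fun h => ?_, fun a => ⟨Set.univ, by simp, by simp⟩⟩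
    exact Set.empty_ne_univ (Set.mem_singleton_iff.1 h)

theorem sparseGame_sumW_nonpos (π : ℕ → Fin 3 × Bool) (n : ℕ) : sparseGame.sumW π n ≤ 0 := by
  refine Finset.sum_nonpos fun i _ => ?_
  change (if _ then (-1 : ℤ) else 0) ≤ 0
  split_ifs <;> simp

theorem sparseGame_neg_le_sumW (π : ℕ → Fin 3 × Bool) (n : ℕ) :
    -(n : ℤ) ≤ sparseGame.sumW π n := by
  have h : ∀ i ∈ Finset.range n,
      (-1 : ℤ) ≤ sparseGame.w (π i).1 (π i).2 (π (i + 1)).1 := by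
    intro i _
    change (-1 : ℤ) ≤ if _ then (-1 : ℤ) else 0
    split_ifs <;> simp
  simpa [sumW] using Finset.sum_le_sum h

theorem sparseGame_MP_nonneg (π : ℕ → Fin 3 × Bool) (C : ℤ)
    (h : ∀ᶠ n : ℕ in atTop, -(C + Nat.sqrt n) ≤ sparseGame.sumW π n) :
    0 ≤ sparseGame.MP π := by
  have hlow : Tendsto (fun n : ℕ => -((C : ℝ) / n + 1 / Real.sqrt n)) atTop (𝓝 0) := by
    have h1 : Tendsto (fun n : ℕ => (C : ℝ) / n) atTop (𝓝 0) :=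
      tendsto_const_div_atTop_nhds_zero_nat _
    have h2 : Tendsto (fun n : ℕ => 1 / Real.sqrt n) atTop (𝓝 0) :=
      tendsto_const_nhds.div_atTop
        (Real.tendsto_sqrt_atTop.comp tendsto_natCast_atTop_atTop)
    simpa using (h1.add h2).neg
  have hlim : Tendsto (fun n : ℕ => (sparseGame.sumW π n : ℝ) / n) atTop (𝓝 0) := by
    refine tendsto_of_tendsto_of_tendsto_of_le_of_le' hlow tendsto_const_nhds ?_ ?_
    · filter_upwards [h, eventually_gt_atTop 0] with n hn hpos
      have hn' : -((C : ℝ) + Nat.sqrt n) ≤ sparseGame.sumW π n := by exact_mod_cast hn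
      have hs : (Nat.sqrt n : ℝ) ≤ Real.sqrt n := Real.nat_sqrt_le_real_sqrt
      have hpos' : (0 : ℝ) < n := by exact_mod_cast hpos
      have hdiv : 1 / Real.sqrt n = Real.sqrt n / n := by
        rw [Real.sqrt_div_self, one_div]
      rw [hdiv, ← add_div, ← neg_div]
      gcongr
      linarith
    · refine Eventually.of_forall fun n => ?_
      have : (sparseGame.sumW π n : ℝ) ≤ 0 := by
        exact_mod_cast sparseGame_sumW_nonpos π n
      exact div_nonpos_of_nonpos_of_nonneg this (Nat.cast_nonneg n)
  exact hlim.liminf_eq.ge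

theorem sparseGame_MP_neg (π : ℕ → Fin 3 × Bool) (m : ℕ) (hm : 0 < m)
    (h : ∃ᶠ n : ℕ in atTop, m * sparseGame.sumW π n ≤ -(n : ℤ)) :
    sparseGame.MP π < 0 := by
  have hm' : (0 : ℝ) < m := by exact_mod_cast hm
  have hbdd : IsBoundedUnder (· ≥ ·) atTop
      (fun n : ℕ => (sparseGame.sumW π n : ℝ) / n) := by
    refine isBoundedUnder_of ⟨-1, fun n => ?_⟩
    have h1 : (-(n : ℝ)) ≤ sparseGame.sumW π n := by
      exact_mod_cast sparseGame_neg_le_sumW π n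
    rcases Nat.eq_zero_or_pos n with rfl | hn
    · simp
    · have hn' : (0 : ℝ) < n := by exact_mod_cast hn
      rw [ge_iff_le, le_div_iff₀ hn']
      linarith
  have hle : sparseGame.MP π ≤ -1 / m := by
    refine liminf_le_of_frequently_le ?_ hbdd
    refine (h.and_eventually (eventually_gt_atTop 0)).mono fun n ⟨hn, hpos⟩ => ?_
    have hn' : (m : ℝ) * sparseGame.sumW π n ≤ -(n : ℝ) := by exact_mod_cast hn
    have hpos' : (0 : ℝ) < n := by exact_mod_cast hpos
    rw [div_le_div_iff₀ hpos' hm']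
    linarith
  exact hle.trans_lt (div_neg_of_neg_of_pos (by norm_num) hm')

theorem sparseGame_isPlay (ψ : ℕ → Set (Fin 3) × Bool) (h : ∀ i, (ψ i).1 = Set.univ) :
    sparseGame.IsPlay ψ := by
  refine ⟨⟨h, fun i => ⟨0, ?_, 0, ?_, Or.inl ⟨rfl, by decide⟩⟩⟩, ?_⟩ <;> rw [h] <;> trivial

theorem card_isSquare_lt_le (n : ℕ) :
    ((Finset.range n).filter fun i => IsSquare i).card ≤ Nat.sqrt n + 1 := by
  have hsub : ((Finset.range n).filter fun i => IsSquare i) ⊆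
      (Finset.range (Nat.sqrt n + 1)).image fun k => k * k := by
    intro i hi
    obtain ⟨hin, r, rfl⟩ := Finset.mem_filter.1 hi
    refine Finset.mem_image.2 ⟨r, ?_, rfl⟩
    rw [Finset.mem_range, Nat.lt_succ_iff, Nat.le_sqrt]
    exact (Finset.mem_range.1 hin).le
  simpa using (Finset.card_le_card hsub).trans Finset.card_image_le

theorem sparseGame_sumW_of_forall_eq_zero (π : ℕ → Fin 3 × Bool) (h : ∀ i, (π i).1 = 0)
    (n : ℕ) :
    sparseGame.sumW π n = -(((Finset.range n).filter fun i => (π i).2 = true).card : ℤ) := by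
  rw [Finset.card_filter]
  push_cast
  rw [← Finset.sum_neg_distrib]
  refine Finset.sum_congr rfl fun i _ => ?_
  change (if _ then (-1 : ℤ) else 0) = _
  rw [h i]
  simp only [true_and, show ¬ ((0 : Fin 3) = 1) by decide, false_and, or_false]
  split_ifs <;> simp

/-- Eve plays `true` exactly at the times that are perfect squares. -/
noncomputable def squareStrategy : sparseGame.EveStrategy :=
  fun h _ => decide (IsSquare h.length)

theorem eveWinningStrategy_squareStrategy :
    sparseGame.EveWinningStrategy squareStrategy := by
  intro ψ _ hcons π ⟨hpath, hγ⟩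
  have hact : ∀ i, (π i).2 = decide (IsSquare i) := fun i => by
    rw [(hγ i).2, hcons i]
    simp [squareStrategy, hist]
  by_cases h0 : ∀ i, (π i).1 = 0
  · refine sparseGame_MP_nonneg π 1 (Eventually.of_forall fun n => ?_)
    rw [sparseGame_sumW_of_forall_eq_zero π h0]
    have := card_isSquare_lt_le n
    simp only [hact, decide_eq_true_eq]
    omega
  · push Not at h0
    obtain ⟨N, hN⟩ := h0
    have hstep : ∀ i, (π i).1 ≠ 0 → (π (i + 1)).1 ≠ 0 := by
      intro i hi
      rcases hpath i with h | h | h | h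
      · exact absurd h.1 hi
      · rw [h.2.2]; decide
      · rw [h.2.2]; decide
      · rw [h.2]; decide
    have hne : ∀ i, N ≤ i → (π i).1 ≠ 0 := fun i hi =>
      Nat.le_induction hN (fun j _ hj => hstep j hj) i hi
    have hNN : N ≤ N * N := Nat.le_mul_self N
    have hsink : (π (N * N + 1)).1 = 2 := by
      have htrue : (π (N * N)).2 = true := by rw [hact]; simp
      rcases hpath (N * N) with h | h | h | h
      · exact absurd h.1 (hne _ hNN)
      · exact absurd (htrue.symm.trans h.2.1) (by decide)
      · exact h.2.2
      · exact h.2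
    have hsink' : ∀ i, N * N + 1 ≤ i → (π i).1 = 2 := fun i hi => by
      induction i, hi using Nat.le_induction with
      | base => exact hsink
      | succ j _ hj =>
        rcases hpath j with h | h | h | h
        · exact absurd (hj.symm.trans h.1) (by decide)
        · exact absurd (hj.symm.trans h.1) (by decide)
        · exact h.2.2
        · exact h.2
    have hconst : ∀ n, N * N + 1 ≤ n →
        sparseGame.sumW π n = sparseGame.sumW π (N * N + 1) := fun n hn => by
      induction n, hn using Nat.le_induction with
      | base => rfl
      | succ j hj ih =>
        rw [← ih, sumW, Finset.sum_range_succ, ← sumW, add_eq_left]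
        change (if _ then (-1 : ℤ) else 0) = 0
        rw [hsink' j hj]
        simp
    refine sparseGame_MP_nonneg π (-sparseGame.sumW π (N * N + 1)) ?_
    filter_upwards [eventually_ge_atTop (N * N + 1)] with n hn
    rw [hconst n hn]
    omega

/-- If Eve plays only `false` from time `N` on, Adam wins by moving to state `1` at time `N`. -/
theorem sparseGame_exists_MP_neg_of_eventually_false (act : ℕ → Bool) (N : ℕ)
    (h : ∀ i, N ≤ i → act i = false) :
    ∃ π, sparseGame.IsConcretePath π ∧ (∀ i, (π i).2 = act i) ∧ sparseGame.MP π < 0 := by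
  let π : ℕ → Fin 3 × Bool := fun i => (if i ≤ N then 0 else 1, act i)
  refine ⟨π, fun i => ?_, fun _ => rfl, ?_⟩
  · by_cases hi : i ≤ N
    · refine Or.inl ⟨if_pos hi, ?_⟩
      change (if i + 1 ≤ N then (0 : Fin 3) else 1) ≠ 2
      split_ifs <;> decide
    · exact Or.inr (Or.inl ⟨if_neg hi, h i (by omega), if_neg (by omega)⟩)
  · have hsum : ∀ n : ℕ, sparseGame.sumW π n ≤ N + 1 - n := by
      intro n
      induction n with
      | zero => simp [sumW]; omega
      | succ n ih =>
        by_cases hn : n ≤ N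
        · have := sparseGame_sumW_nonpos π (n + 1)
          push_cast
          omega
        · rw [sumW, Finset.sum_range_succ, ← sumW]
          have hw : sparseGame.w (π n).1 (π n).2 (π (n + 1)).1 = -1 :=
            if_pos (Or.inr ⟨if_neg hn, h n (by omega)⟩)
          rw [hw]
          push_cast
          omega
    refine sparseGame_MP_neg π 2 two_pos (Eventually.frequently ?_)
    filter_upwards [eventually_ge_atTop (2 * (N + 1))] with n hn
    have := hsum n
    push_cast
    omega

/-- If Eve plays `true` along an arithmetic progression, Adam wins by staying in state `0`. -/
theorem sparseGame_exists_MP_neg_of_periodic_true (act : ℕ → Bool) (k p : ℕ) (hp : 0 < p)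
    (h : ∀ t, act (k + t * p) = true) :
    ∃ π, sparseGame.IsConcretePath π ∧ (∀ i, (π i).2 = act i) ∧ sparseGame.MP π < 0 := by
  let π : ℕ → Fin 3 × Bool := fun i => (0, act i)
  refine ⟨π, fun i => Or.inl ⟨rfl, (by decide : (0 : Fin 3) ≠ 2)⟩, fun _ => rfl, ?_⟩
  have hcount : ∀ t : ℕ, sparseGame.sumW π (k + t * p) ≤ -(t : ℤ) := by
    intro t
    have hsub : (Finset.range t).image (fun s => k + s * p) ⊆
        (Finset.range (k + t * p)).filter fun i => (π i).2 = true := by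
      intro i hi
      obtain ⟨s, hs, rfl⟩ := Finset.mem_image.1 hi
      refine Finset.mem_filter.2 ⟨Finset.mem_range.2 ?_, h s⟩
      have := Nat.mul_lt_mul_of_pos_right (Finset.mem_range.1 hs) hp
      omega
    have hcard := Finset.card_le_card hsub
    rw [Finset.card_image_of_injective, Finset.card_range] at hcard
    · rw [sparseGame_sumW_of_forall_eq_zero π fun _ => rfl]
      omega
    · intro s s' hss
      exact Nat.eq_of_mul_eq_mul_right hp (Nat.add_left_cancel hss)
  refine sparseGame_MP_neg π (k + p) (by omega) (frequently_atTop.2 fun a => ?_)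
  refine ⟨k + (a + 1) * p, by nlinarith, ?_⟩
  have := hcount (a + 1)
  push_cast at this ⊢
  nlinarith [mul_nonneg (Int.natCast_nonneg k) (Int.natCast_nonneg a),
    mul_le_mul_of_nonneg_left this (by positivity : (0 : ℤ) ≤ k + p)]

/-- Every word produced by a finite automaton without input loses in `sparseGame`. -/
theorem sparseGame_exists_MP_neg_of_finite {M : Type} [Finite M] (f : M → M) (g : M → Bool)
    (m₀ : M) :
    ∃ π, sparseGame.IsConcretePath π ∧ (∀ i, (π i).2 = g (f^[i] m₀)) ∧
      sparseGame.MP π < 0 := by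
  by_cases hev : ∃ N, ∀ i, N ≤ i → g (f^[i] m₀) = false
  · obtain ⟨N, hN⟩ := hev
    exact sparseGame_exists_MP_neg_of_eventually_false _ N hN
  · push Not at hev
    obtain ⟨i, j, hij, heq⟩ := Finite.exists_ne_map_eq_of_infinite fun n => f^[n] m₀
    wlog hlt : i < j generalizing i j
    · exact this j i hij.symm heq.symm (by omega)
    obtain ⟨k, hk, htrue⟩ := hev i
    refine sparseGame_exists_MP_neg_of_periodic_true _ k (j - i) (by omega) fun t => ?_
    have hper : ∀ n, i ≤ n → f^[n + (j - i)] m₀ = f^[n] m₀ := fun n hn => by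
      have h1 : n + (j - i) = (n - i) + j := by omega
      have h2 : n = (n - i) + i := by omega
      rw [h1, Function.iterate_add_apply]
      conv_rhs => rw [h2, Function.iterate_add_apply]
      exact congrArg _ heq.symm
    have hiter : f^[k + t * (j - i)] m₀ = f^[k] m₀ := by
      induction t with
      | zero => simp
      | succ t ih => rw [Nat.succ_mul, ← add_assoc, hper _ (by omega), ih]
    rw [hiter]
    simpa using htrue

theorem not_eveWinningStrategy_of_finiteMemory (st : sparseGame.EveStrategy)
    (hst : sparseGame.FiniteMemory st) : ¬ sparseGame.EveWinningStrategy st := by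
  obtain ⟨_, M, inst, m₀, αu, αo, -, hmem⟩ := hst
  intro hwin
  obtain ⟨π, hpath, hact, hneg⟩ := sparseGame_exists_MP_neg_of_finite
    (fun x => αu x Set.univ) (fun x => αo x Set.univ) m₀
  let ψ : ℕ → Set (Fin 3) × Bool := fun i => (Set.univ, (π i).2)
  have hplay : sparseGame.IsPlay ψ := sparseGame_isPlay ψ fun _ => rfl
  have hfold : ∀ i, (sparseGame.hist ψ i).foldl (fun x p => αu x p.1) m₀ =
      (fun x => αu x Set.univ)^[i] m₀ := by
    intro i
    induction i with
    | zero => rfl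
    | succ i ih =>
      have hsucc : sparseGame.hist ψ (i + 1) = sparseGame.hist ψ i ++ [ψ i] := by
        simp [hist, List.range_succ]
      rw [hsucc, List.foldl_append, ih, Function.iterate_succ_apply']
      rfl
  have hcons : sparseGame.ConsistentE st ψ := fun i => by
    rw [hmem ψ hplay i, hfold]
    exact hact i
  exact absurd (hwin ψ hplay hcons π ⟨hpath, fun _ => ⟨trivial, rfl⟩⟩) (not_le.2 hneg)

end MPG

/-- There exists a mean-payoff game with partial-observation `G` such that
Eve has a winning observation-based strategy in `G`, but no observation-based strategy
of Eve with finite memory is winning in `G`. -/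
theorem exists_mpg_eve_needs_infinite_memory :
    ∃ G : MPG, (∃ st : G.EveStrategy, G.EveWinningStrategy st) ∧
      ∀ st : G.EveStrategy, G.FiniteMemory st → ¬ G.EveWinningStrategy st := by
  exact ⟨MPG.sparseGame, ⟨_, MPG.eveWinningStrategy_squareStrategy⟩,
    MPG.not_eveWinningStrategy_of_finiteMemory⟩
end

section
/- The predicate 'Eve has a winning observation-based strategy in G' on (codes of) finite MPGs with partial-observation is not a decidable (computable) predicate; that is, there is no algorithm that, given an encoding of a finite MPG with partial-observation as a natural number, decides whether Eve has a winning observation-based strategy ensuring liminf mean payoff ≥ 0. -/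
open Classical

/-- Effective codes for finite MPGs: number of states, number of actions, initial
state, weighted transition table, and list of observations. -/
abbrev GameCode : Type :=
  ℕ × ℕ × ℕ × List (ℕ × ℕ × ℕ × ℤ) × List (List ℕ)

namespace GameCode

def nQ (c : GameCode) : ℕ := c.1
def nA (c : GameCode) : ℕ := c.2.1
def iq (c : GameCode) : ℕ := c.2.2.1
def trans (c : GameCode) : List (ℕ × ℕ × ℕ × ℤ) := c.2.2.2.1
def obsL (c : GameCode) : List (List ℕ) := c.2.2.2.2

/-- Well-formed codes. -/
structure WF (c : GameCode) : Prop where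
  hqI : c.iq < c.nQ
  hnA : 0 < c.nA
  htotal : ∀ q < c.nQ, ∀ a < c.nA, ∃ q' < c.nQ, ∃ z : ℤ, (q, a, q', z) ∈ c.trans
  hrange : ∀ x ∈ c.trans, x.1 < c.nQ ∧ x.2.1 < c.nA ∧ x.2.2.1 < c.nQ
  hwfun : ∀ q a q' z z', (q, a, q', z) ∈ c.trans → (q, a, q', z') ∈ c.trans → z = z'
  hpart : Setoid.IsPartition
    {s : Set (Fin c.nQ) | ∃ l ∈ c.obsL, s = {q : Fin c.nQ | (q : ℕ) ∈ l}}

/-- The finite MPG denoted by a well-formed code. -/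
noncomputable def toMPG (c : GameCode) (h : WF c) : MPG where
  Q := Fin c.nQ
  A := Fin c.nA
  fintypeQ := inferInstance
  decEqQ := inferInstance
  fintypeA := inferInstance
  nonemptyA := ⟨⟨0, h.hnA⟩⟩
  qI := ⟨c.iq, h.hqI⟩
  delta := fun q a q' => ∃ z : ℤ, ((q : ℕ), (a : ℕ), (q' : ℕ), z) ∈ c.trans
  total := fun q a => by
    obtain ⟨q', hq', z, hz⟩ := h.htotal q q.isLt a a.isLt
    exact ⟨⟨q', hq'⟩, z, hz⟩
  w := fun q a q' =>
    if hz : ∃ z : ℤ, ((q : ℕ), (a : ℕ), (q' : ℕ), z) ∈ c.trans then hz.choose else 0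
  Obs := {s : Set (Fin c.nQ) | ∃ l ∈ c.obsL, s = {q : Fin c.nQ | (q : ℕ) ∈ l}}
  partition := h.hpart

end GameCode

namespace CounterMachine

/-- Instructions of a counter machine with control type `C`: `inc r t` increments register `r`
and jumps to `t`; `jzd r t z` jumps to `z` if register `r` is zero, and otherwise decrements it
and jumps to `t`. -/
inductive Instr (C : Type) : Type
  | halt : Instr C
  | inc (r : ℕ) (t : C) : Instr C
  | jzd (r : ℕ) (t z : C) : Instr C

/-- One step of a counter machine; halting configurations are fixed. -/
def step {C : Type} (M : C → Instr C) (x : C × (ℕ → ℕ)) : C × (ℕ → ℕ) :=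
  match M x.1 with
  | .halt => x
  | .inc r t => (t, Function.update x.2 r (x.2 r + 1))
  | .jzd r t z => if x.2 r = 0 then (z, x.2) else (t, Function.update x.2 r (x.2 r - 1))

/-- The machine reaches a halting instruction from the configuration `x`. -/
def HaltsFrom {C : Type} (M : C → Instr C) (x : C × (ℕ → ℕ)) : Prop :=
  ∃ t, M ((step M)^[t] x).1 = .halt

/-- The configuration `y` is reached from `x` in at least one step. -/
def Reaches {C : Type} (M : C → Instr C) (x y : C × (ℕ → ℕ)) : Prop :=
  ∃ n, (step M)^[n + 1] x = y

lemma Reaches.of_step {C : Type} {M : C → Instr C} {x y : C × (ℕ → ℕ)} (h : step M x = y) :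
    Reaches M x y := ⟨0, h⟩

lemma Reaches.trans {C : Type} {M : C → Instr C} {x y z : C × (ℕ → ℕ)}
    (h : Reaches M x y) (h' : Reaches M y z) : Reaches M x z := by
  obtain ⟨n, rfl⟩ := h
  obtain ⟨k, rfl⟩ := h'
  exact ⟨k + 1 + n, by rw [← Function.iterate_add_apply]; rfl⟩

lemma iterate_step_of_halt {C : Type} {M : C → Instr C} {x : C × (ℕ → ℕ)}
    (h : M x.1 = .halt) (n : ℕ) : (step M)^[n] x = x := by
  have hx : step M x = x := by simp [step, h]
  exact Function.iterate_fixed hx n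

lemma not_haltsFrom_of_reaches {C : Type} {M : C → Instr C} (X : ℕ → C × (ℕ → ℕ))
    (hX : ∀ k, Reaches M (X k) (X (k + 1))) (hM : ∀ k, M (X k).1 ≠ .halt) :
    ¬ HaltsFrom M (X 0) := by
  rintro ⟨t, ht⟩
  have key : ∀ k, ∃ n ≥ k, (step M)^[n] (X 0) = X k := by
    intro k
    induction k with
    | zero => exact ⟨0, le_rfl, rfl⟩
    | succ k ih =>
      obtain ⟨n, hn, h⟩ := ih
      obtain ⟨j, hj⟩ := hX k
      refine ⟨(j + 1) + n, by omega, ?_⟩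
      rw [Function.iterate_add_apply, h, hj]
  obtain ⟨n, hn, h⟩ := key t
  obtain ⟨d, rfl⟩ := Nat.exists_eq_add_of_le' hn
  rw [Function.iterate_add_apply, iterate_step_of_halt ht] at h
  exact hM t (h ▸ ht)

/-- Structured counter programs; `loop r p` is `while r ≠ 0 do (decrement r; p)`. -/
inductive Prog : Type
  | inc (r : ℕ) : Prog
  | dec (r : ℕ) : Prog
  | seq (p q : Prog) : Prog
  | loop (r : ℕ) (p : Prog) : Prog

/-- Big-step semantics of structured counter programs. -/
inductive Exec : Prog → (ℕ → ℕ) → (ℕ → ℕ) → Prop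
  | inc (r : ℕ) (c : ℕ → ℕ) : Exec (.inc r) c (Function.update c r (c r + 1))
  | dec (r : ℕ) (c : ℕ → ℕ) : Exec (.dec r) c (Function.update c r (c r - 1))
  | seq {p q : Prog} {c c' c'' : ℕ → ℕ} :
      Exec p c c' → Exec q c' c'' → Exec (.seq p q) c c''
  | loop_zero {r : ℕ} {p : Prog} {c : ℕ → ℕ} : c r = 0 → Exec (.loop r p) c c
  | loop_succ {r : ℕ} {p : Prog} {c c' c'' : ℕ → ℕ} : c r ≠ 0 →
      Exec p (Function.update c r (c r - 1)) c' → Exec (.loop r p) c' c'' →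
      Exec (.loop r p) c c''

/-- Control points of a structured program. -/
def Point : Prog → Type
  | .inc _ => Unit
  | .dec _ => Unit
  | .seq p q => Point p ⊕ Point q
  | .loop _ p => Option (Point p)

lemma finite_point (p : Prog) : Finite (Point p) := by
  induction p with
  | inc r => exact inferInstanceAs (Finite Unit)
  | dec r => exact inferInstanceAs (Finite Unit)
  | seq p q hp hq => exact inferInstanceAs (Finite (Point p ⊕ Point q))
  | loop r p hp => exact inferInstanceAs (Finite (Option (Point p)))

/-- The first control point of a structured program. -/
def entry : (p : Prog) → Point p
  | .inc _ => ()
  | .dec _ => ()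
  | .seq p _ => Sum.inl (entry p)
  | .loop _ _ => none

/-- Compilation of a structured program whose control points are embedded in `X` and which
exits to `k`. -/
def compile {X : Type} : (p : Prog) → (Point p → X) → X → Point p → Instr X
  | .inc r, _, k, _ => .inc r k
  | .dec r, _, k, _ => .jzd r k k
  | .seq p q, f, k, x =>
      Sum.elim (compile p (fun y => f (Sum.inl y)) (f (Sum.inr (entry q))))
        (compile q (fun y => f (Sum.inr y)) k) x
  | .loop r p, f, k, x =>
      Option.elim x (.jzd r (f (some (entry p))) k)
        (compile p (fun y => f (some y)) (f none))

theorem Exec.reaches {p : Prog} {c c' : ℕ → ℕ} (h : Exec p c c') {X : Type} {M : X → Instr X}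
    (f : Point p → X) (k : X) (hM : ∀ x, M (f x) = compile p f k x) :
    Reaches M (f (entry p), c) (k, c') := by
  induction h generalizing k with
  | inc r c => exact .of_step (by simp [step, hM, compile])
  | dec r c =>
    refine .of_step ?_
    by_cases hc : c r = 0
    · have : Function.update c r 0 = c := by rw [← hc, Function.update_eq_self]
      simp [step, hM, compile, hc, this]
    · simp [step, hM, compile, hc]
  | @seq p q c c' c'' _ _ ih₁ ih₂ =>
    exact (ih₁ (fun y => f (Sum.inl y)) (f (Sum.inr (entry q))) fun x => hM (Sum.inl x)).trans
      (ih₂ (fun y => f (Sum.inr y)) k fun x => hM (Sum.inr x))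
  | @loop_zero r p c hc =>
    refine .of_step ?_
    have := hM none
    simp only [compile, Option.elim] at this
    simp [step, entry, this, hc]
  | @loop_succ r p c c' c'' hc _ _ ih₁ ih₂ =>
    have h0 := hM none
    simp only [compile, Option.elim] at h0
    refine Reaches.trans (y := (f (some (entry p)), Function.update c r (c r - 1)))
      (.of_step (by simp [step, entry, h0, hc])) ?_
    exact (ih₁ (fun y => f (some y)) (f none) fun x => hM (some x)).trans (ih₂ f k hM)

open Function in
/-- A loop whose body runs through the states `s 0, s 1, …`. -/
lemma exec_loop {r : ℕ} {p : Prog} (N : ℕ) (s : ℕ → ℕ → ℕ) (hr : ∀ i ≤ N, s i r = N - i)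
    (h : ∀ i < N, Exec p (update (s i) r (N - i - 1)) (s (i + 1))) :
    Exec (.loop r p) (s 0) (s N) := by
  induction N generalizing s with
  | zero => exact .loop_zero (by simpa using hr 0 le_rfl)
  | succ N ih =>
    refine .loop_succ (c' := s 1) ?_ ?_ (ih (fun i => s (i + 1)) ?_ ?_)
    · rw [hr 0 (by omega)]; omega
    · have := h 0 (by omega)
      rwa [hr 0 (by omega)]
    · intro i hi
      have := hr (i + 1) (by omega)
      omega
    · intro i hi
      have := h (i + 1) (by omega)
      rwa [show N + 1 - (i + 1) - 1 = N - i - 1 by omega] at this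

open Function in
lemma exec_clear (r : ℕ) (c : ℕ → ℕ) : Exec (.loop r (.dec r)) c (update c r 0) := by
  induction hn : c r using Nat.strong_induction_on generalizing c with
  | _ n ih =>
    by_cases h0 : c r = 0
    · rw [show update c r 0 = c by rw [← h0, update_eq_self]]
      exact .loop_zero h0
    · refine .loop_succ h0 (.dec _ _) ?_
      have := ih (n - 1 - 1) (by omega) (update c r (n - 1 - 1)) (by simp)
      simpa [hn] using this

open Function in
lemma exec_move {r d : ℕ} (hrd : r ≠ d) (c : ℕ → ℕ) :
    Exec (.loop r (.inc d)) c (update (update c d (c d + c r)) r 0) := by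
  have := exec_loop (r := r) (p := .inc d) (c r)
    (fun i => update (update c d (c d + i)) r (c r - i)) (by simp) (by
      intro i hi
      convert Exec.inc d _ using 1
      ext j
      simp only [update_apply]
      grind)
  simpa using this

open Function in
lemma exec_copy {r o t : ℕ} (hro : r ≠ o) (hrt : r ≠ t) (hot : o ≠ t) (c : ℕ → ℕ)
    (ho : c o = 0) (ht : c t = 0) :
    Exec (.seq (.loop r (.seq (.inc o) (.inc t))) (.loop t (.inc r))) c (update c o (c r)) := by
  have h1 := exec_loop (r := r) (p := .seq (.inc o) (.inc t)) (c r)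
    (fun i => update (update (update c o i) t i) r (c r - i)) (by simp) (by
      intro i hi
      convert Exec.seq (Exec.inc o _) (Exec.inc t _) using 1
      ext j
      simp only [update_apply]
      grind)
  have h2 := exec_move hrt.symm (update (update (update c o (c r)) t (c r)) r (c r - c r))
  convert Exec.seq (h1) h2 using 1
  · ext j
    simp only [update_apply]
    grind
  · ext j
    simp only [update_apply]
    grind

/-- `f` is computed by programs with arbitrary input registers `ins`, output register `o`,
and scratch registers `≥ b`, which restore everything but the output register. -/
def Computes {n : ℕ} (f : List.Vector ℕ n → ℕ) : Prop :=
  ∀ (ins : Fin n → ℕ) (o b : ℕ), (∀ i, ins i < b) → o < b → (∀ i, ins i ≠ o) →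
    ∃ p, ∀ (c : ℕ → ℕ) (v : List.Vector ℕ n), (∀ i, c (ins i) = v.get i) → c o = 0 →
      (∀ r ≥ b, c r = 0) → Exec p c (Function.update c o (f v))

open Function in
lemma computes_get {n : ℕ} (i : Fin n) : Computes fun v : List.Vector ℕ n => v.get i := by
  intro ins o b hi ho hio
  refine ⟨.seq (.loop (ins i) (.seq (.inc o) (.inc b))) (.loop b (.inc (ins i))),
    fun c v hv hco hb => ?_⟩
  change Exec _ c (update c o (v.get i))
  rw [← hv i]
  exact exec_copy (hio i) (t := b) (hi i).ne ho.ne c hco (hb b le_rfl)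

open Function in
lemma computes_succ : Computes fun v : List.Vector ℕ 1 => v.head.succ := by
  intro ins o b hi ho hio
  obtain ⟨p, hp⟩ := computes_get (0 : Fin 1) ins o b hi ho hio
  refine ⟨.seq p (.inc o), fun c v hv hco hb => ?_⟩
  convert Exec.seq (hp c v hv hco hb) (.inc o _) using 1
  simp

open Function in
lemma computes_zero : Computes fun _ : List.Vector ℕ 0 => 0 := by
  intro ins o b hi ho hio
  refine ⟨.dec o, fun c v hv hco hb => ?_⟩
  convert Exec.dec o c using 1
  simp [hco]

lemma exists_exec_clear (o b j : ℕ) : ∃ p, ∀ c : ℕ → ℕ, c o = 0 →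
    Exec p c (fun r => if b ≤ r ∧ r < b + j then 0 else c r) := by
  induction j with
  | zero =>
    refine ⟨.dec o, fun c hc => ?_⟩
    convert Exec.dec o c using 1
    ext r
    simp only [Function.update_apply]
    grind
  | succ j ih =>
    obtain ⟨p, hp⟩ := ih
    refine ⟨.seq (.loop (b + j) (.dec (b + j))) p, fun c hc => ?_⟩
    convert Exec.seq (exec_clear (b + j) c) (hp _ _) using 1
    · ext r
      simp only [Function.update_apply]
      grind
    · simp only [Function.update_apply]
      grind

lemma computes_comp {m n : ℕ} {f : List.Vector ℕ n → ℕ} (g : Fin n → List.Vector ℕ m → ℕ)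
    (hf : Computes f) (hg : ∀ i, Computes (g i)) :
    Computes fun a => f (List.Vector.ofFn fun i => g i a) := by
  intro ins o b hi ho hio
  have key : ∀ j ≤ n, ∃ p, ∀ (c : ℕ → ℕ) (v : List.Vector ℕ m), (∀ i, c (ins i) = v.get i) →
      c o = 0 → (∀ r ≥ b, c r = 0) →
      Exec p c (fun r => if h : b ≤ r ∧ r < b + j ∧ r - b < n then g ⟨r - b, h.2.2⟩ v
        else c r) := by
    intro j
    induction j with
    | zero =>
      refine fun _ => ⟨.dec o, fun c v hv hco hb => ?_⟩
      convert Exec.dec o c using 1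
      ext r
      simp only [Function.update_apply]
      grind
    | succ j ih =>
      intro hj
      obtain ⟨p, hp⟩ := ih (by omega)
      obtain ⟨q, hq⟩ := hg ⟨j, hj⟩ ins (b + j) (b + n) (fun i => (hi i).trans_le (by omega))
        (by omega) (fun i => ((hi i).trans_le (by omega)).ne)
      refine ⟨.seq p q, fun c v hv hco hb => ?_⟩
      convert Exec.seq (hp c v hv hco hb) (hq _ v ?_ ?_ ?_) using 1
      · ext r
        simp only [Function.update_apply]
        by_cases hr : r = b + j
        · subst hr
          simp
          grind
        · grind
      · intro i
        have := hi i
        rw [dif_neg (by omega), hv]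
      · rw [dif_neg (by omega)]
        exact hb _ (by omega)
      · intro r hr
        rw [dif_neg (by omega)]
        exact hb _ (by omega)
  obtain ⟨p, hp⟩ := key n le_rfl
  obtain ⟨q, hq⟩ := hf (fun i => b + i) o (b + n) (fun i => by omega) (by omega)
    (fun i => by omega)
  obtain ⟨s, hs⟩ := exists_exec_clear (b + n) b n
  refine ⟨.seq p (.seq q s), fun c v hv hco hb => ?_⟩
  refine .seq (hp c v hv hco hb) (.seq (hq _ (List.Vector.ofFn fun i => g i v) ?_ ?_ ?_) ?_)
  · intro i
    simp
  · rw [dif_neg (by omega), hco]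
  · intro r hr
    rw [dif_neg (by omega)]
    exact hb _ (by omega)
  · convert hs (Function.update _ o _) ?_ using 1
    · ext r
      simp only [Function.update_apply]
      grind
    · rw [Function.update_of_ne (by omega), dif_neg (by omega)]
      exact hb _ (by omega)

open Function in
lemma computes_prec {n : ℕ} {f : List.Vector ℕ n → ℕ} {g : List.Vector ℕ (n + 2) → ℕ}
    (hf : Computes f) (hg : Computes g) :
    Computes fun v : List.Vector ℕ (n + 1) =>
      v.head.rec (f v.tail) fun y IH => g (y ::ᵥ IH ::ᵥ v.tail) := by
  intro ins o b hi ho hio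
  obtain ⟨p₁, h₁⟩ := computes_get (0 : Fin (n + 1)) ins b (b + 4)
    (fun i => (hi i).trans (by omega)) (by omega) (fun i => (hi i).ne)
  obtain ⟨p₂, h₂⟩ := hf (fun i => ins i.succ) (b + 2) (b + 4)
    (fun i => (hi _).trans (by omega)) (by omega) (fun i => ((hi _).trans (by omega)).ne)
  obtain ⟨p₃, h₃⟩ := hg (Fin.cons (b + 1) (Fin.cons (b + 2) fun i => ins i.succ)) (b + 3) (b + 4)
    (by
      refine Fin.cases (by simp) (Fin.cases (by simp) fun i => ?_)
      have := hi i.succ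
      simp only [Fin.cons_succ]
      omega) (by omega)
    (by
      refine Fin.cases (by simp) (Fin.cases (by simp) fun i => ?_)
      have := hi i.succ
      simp only [Fin.cons_succ]
      omega)
  refine ⟨.seq p₁ (.seq p₂ (.seq (.loop b (.seq p₃ (.seq (.loop (b + 2) (.dec (b + 2)))
    (.seq (.loop (b + 3) (.inc (b + 2))) (.inc (b + 1))))))
    (.seq (.loop (b + 2) (.inc o)) (.loop (b + 1) (.dec (b + 1)))))),
    fun c v hv hco hb => ?_⟩
  set N := v.head with hN
  set R : ℕ → ℕ := fun k => Nat.rec (f v.tail) (fun y IH => g (y ::ᵥ IH ::ᵥ v.tail)) k with hR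
  have hget : v.get 0 = N := by simp [hN]
  have hb0 := hb b le_rfl
  have hb1 := hb (b + 1) (by omega)
  have hb2 := hb (b + 2) (by omega)
  have hb3 := hb (b + 3) (by omega)
  have hloop := exec_loop (r := b) (p := .seq p₃ (.seq (.loop (b + 2) (.dec (b + 2)))
    (.seq (.loop (b + 3) (.inc (b + 2))) (.inc (b + 1))))) N
    (fun i => update (update (update c (b + 2) (R i)) (b + 1) i) b (N - i)) (by simp) (by
      intro i hiN
      have e₃ := h₃ (update (update (update c (b + 2) (R i)) (b + 1) i) b (N - i - 1))
        (i ::ᵥ R i ::ᵥ v.tail) (by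
          refine Fin.cases (by simp) (Fin.cases (by simp; rfl) fun j => ?_)
          have := hi j.succ
          have := hv j.succ
          simp only [Fin.cons_succ, update_apply, List.Vector.get_cons_succ,
            List.Vector.get_tail_succ]
          grind)
        (by simp [hb3]) (by
          intro r hr
          simp only [update_apply]
          grind)
      convert e₃.seq ((exec_clear (b + 2) _).seq
        ((exec_move (r := b + 3) (d := b + 2) (by omega) _).seq (.inc (b + 1) _))) using 1
      · simp
      · have hRi : R (i + 1) = g (i ::ᵥ R i ::ᵥ v.tail) := rfl
        ext r
        simp only [update_apply]
        grind)
  have e₁ := h₁ c v hv hb0 (fun r hr => hb r (by omega))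
  change Exec p₁ c (update c b (v.get 0)) at e₁
  rw [hget] at e₁
  have e₂ := h₂ (update c b N) v.tail (by
    intro j
    have := hi j.succ
    have := hv j.succ
    rw [update_of_ne (by omega), this]
    simp) (by simp [hb2]) (by
      intro r hr
      rw [update_of_ne (by omega)]
      exact hb r (by omega))
  have hR0 : R 0 = f v.tail := rfl
  have e₃ : Exec (.loop b (.seq p₃ (.seq (.loop (b + 2) (.dec (b + 2)))
      (.seq (.loop (b + 3) (.inc (b + 2))) (.inc (b + 1))))))
      (update (update c b N) (b + 2) (f v.tail))
      (update (update (update c (b + 2) (R N)) (b + 1) N) b (N - N)) := by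
    convert hloop using 1
    ext r
    simp only [update_apply]
    grind
  have e₄ := exec_move (r := b + 2) (d := o) (by omega)
    (update (update (update c (b + 2) (R N)) (b + 1) N) b (N - N))
  change Exec _ c (update c o (R N))
  convert e₁.seq (e₂.seq (e₃.seq (e₄.seq (exec_clear (b + 1) _)))) using 1
  ext r
  simp only [update_apply]
  grind

theorem computes_of_primrec' {n : ℕ} {f : List.Vector ℕ n → ℕ} (hf : Nat.Primrec' f) :
    Computes f := by
  induction hf with
  | zero => exact computes_zero
  | succ => exact computes_succ
  | get i => exact computes_get i
  | comp g _ _ hf hg => exact computes_comp g hf hg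
  | prec _ _ hf hg => exact computes_prec hf hg

/-- Starting registers for the input `n`. -/
def input (n : ℕ) : ℕ → ℕ := fun r => if r = 0 then n + 1 else if r = 2 then 1 else 0

open Function in
/-- Unbounded search for a zero of a primitive recursive function by a counter machine. -/
theorem exists_machine_search (g : ℕ → ℕ → ℕ) (hg : Primrec₂ g) :
    ∃ (C : Type) (_ : Finite C) (M : C → Instr C) (q : C),
      ∀ n, HaltsFrom M (q, input n) ↔ ∃ k, g k (n + 1) = 0 := by
  obtain ⟨p, hp⟩ := computes_of_primrec' (Nat.Primrec'.prim_iff₂.2 hg) ![1, 0] 2 3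
    (by simp [Fin.forall_fin_two]) (by omega) (by simp [Fin.forall_fin_two])
  let body : Prog := .seq (.loop 2 (.dec 2)) (.seq p (.inc 1))
  let top : Prog := .loop 2 body
  have := finite_point top
  let M : Option (Point top) → Instr (Option (Point top)) := fun x =>
    x.elim .halt (compile top some none)
  refine ⟨Option (Point top), inferInstance, M, some (entry top), fun n => ?_⟩
  let F : ℕ → ℕ → ℕ := fun k => update (update (input n) 1 k) 2
    (match k with | 0 => 1 | k + 1 => g k (n + 1))
  have hF0 : F 0 = input n := by
    ext r
    simp only [F, input, update_apply]
    grind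
  have hbody : ∀ k, Exec body (update (F k) 2 (F k 2 - 1)) (F (k + 1)) := by
    intro k
    have e := hp (update (update (F k) 2 (F k 2 - 1)) 2 0) (k ::ᵥ (n + 1) ::ᵥ .nil)
      (by
        rw [Fin.forall_fin_two]
        constructor
        · simp [F]
        · simp [F, input]; rfl) (by simp)
        (by
          intro r hr
          simp only [F, input, update_apply]
          grind)
    convert (exec_clear _ _).seq (e.seq (.inc _ _)) using 1
    ext r
    simp only [F, List.Vector.head_cons, List.Vector.tail_cons, update_apply]
    grind
  constructor
  · intro hh
    by_contra! hne
    refine not_haltsFrom_of_reaches (M := M) (fun k => (some (entry top), F k)) ?_ ?_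
      (by simpa only [hF0] using hh)
    · intro k
      have hk : F k 2 ≠ 0 := by
        cases k with
        | zero => simp [F]
        | succ k => simpa [F] using hne k
      refine Reaches.trans (.of_step (y := (some (some (entry body)), update (F k) 2 (F k 2 - 1)))
        ?_) ((hbody k).reaches (M := M) (fun y => some (some y)) (some none) fun x => rfl)
      have hM : M (some none) = .jzd 2 (some (some (entry body))) none := rfl
      simp [step, entry, top, hM, hk]
      rfl
    · intro k h
      exact Instr.noConfusion rfl (heq_of_eq h)
  · intro hk
    have hex : ∀ d k, F (k + d) 2 = 0 → ∃ c', Exec top (F k) c' := by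
      intro d
      induction d with
      | zero => exact fun k hk => ⟨_, .loop_zero hk⟩
      | succ d ih =>
        intro k hk
        by_cases h0 : F k 2 = 0
        · exact ⟨_, .loop_zero h0⟩
        · obtain ⟨c', hc'⟩ := ih (k + 1) (by rwa [show k + 1 + d = k + (d + 1) by omega])
          exact ⟨c', .loop_succ h0 (hbody k) hc'⟩
    obtain ⟨k, hk⟩ := hk
    obtain ⟨c', hc'⟩ := hex (k + 1) 0 (by simpa [F] using hk)
    obtain ⟨t, ht⟩ := hc'.reaches (M := M) some none fun x => rfl
    rw [hF0] at ht
    exact ⟨t + 1, by rw [ht]; rfl⟩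

/-- Some counter machine has an undecidable halting problem. -/
theorem exists_machine_undecidable :
    ∃ (C : Type) (_ : Finite C) (M : C → Instr C) (q : C),
      ¬ ComputablePred fun n => HaltsFrom M (q, input n) := by
  let g : ℕ → ℕ → ℕ := fun k m => if (Nat.Partrec.Code.evaln k
    (Denumerable.ofNat Nat.Partrec.Code (m - 1)) 0).isSome = true then 0 else 1
  have hg : Primrec₂ g := by
    have h : Primrec fun x : ℕ × ℕ => Nat.Partrec.Code.evaln x.1
        (Denumerable.ofNat Nat.Partrec.Code (x.2 - 1)) 0 :=
      Nat.Partrec.Code.primrec_evaln.comp ((Primrec.fst.pair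
        ((Primrec.ofNat _).comp (Primrec.pred.comp Primrec.snd))).pair (Primrec.const 0))
    exact Primrec.ite (Primrec.eq.comp (Primrec.option_isSome.comp h) (Primrec.const true))
      (Primrec.const 0) (Primrec.const 1)
  obtain ⟨C, hC, M, q, hM⟩ := exists_machine_search g hg
  refine ⟨C, hC, M, q, fun hcomp => ComputablePred.halting_problem 0 ?_⟩
  rw [ComputablePred.computable_iff] at hcomp ⊢
  obtain ⟨f, hf, hfM⟩ := hcomp
  refine ⟨fun c => f (Encodable.encode c), hf.comp Computable.encode, ?_⟩
  ext c
  rw [← congrFun hfM (Encodable.encode c), hM, Part.dom_iff_mem]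
  simp only [Nat.Partrec.Code.evaln_complete, g, Nat.add_sub_cancel, Denumerable.ofNat_encode,
    ite_eq_left_iff, one_ne_zero, imp_false, not_not, Option.isSome_iff_exists, Option.mem_def]
  exact exists_comm

/-- Modes of the simulation: `pos i` and `neg i` track register `i` and its negation, `cnt`
tracks twice the number of simulated steps, and `chg` charges the idle actions. -/
inductive Mode (B : ℕ) : Type
  | pos (i : Fin B) : Mode B
  | neg (i : Fin B) : Mode B
  | cnt : Mode B
  | chg : Mode B

instance (B : ℕ) : Finite (Mode B) :=
  Finite.of_surjective (α := (Fin B ⊕ Fin B) ⊕ Bool)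
    (Sum.elim (Sum.elim .pos .neg) fun b => cond b .cnt .chg) (by
      rintro (i | i | _ | _)
      exacts [⟨.inl (.inl i), rfl⟩, ⟨.inl (.inr i), rfl⟩, ⟨.inr true, rfl⟩, ⟨.inr false, rfl⟩])

/-- States of the game: `none` is the initial state, and `some (m, q)` simulates the control
state `q` in mode `m`. -/
abbrev GState (C : Type) (B : ℕ) : Type := Option (Mode B × C)

section Game

variable {C : Type} {B : ℕ} (M : C → Instr C) (q₀ : C)

/-- The successor of a control state: action `0` is idle, `1` claims that the tested register is
nonzero, and `2` claims that it is zero. -/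
def nxt (q : C) (a : Fin 3) : C :=
  match M q with
  | .halt => q
  | .inc _ t => if a = 0 then q else t
  | .jzd _ t z => if a = 0 then q else if a = 1 then t else z

/-- The claimed change of register `i`. -/
def change (q : C) (a : Fin 3) (i : ℕ) : ℤ :=
  match M q with
  | .halt => 0
  | .inc r _ => if a ≠ 0 ∧ r = i then 1 else 0
  | .jzd r _ _ => if a = 1 ∧ r = i then -1 else 0

/-- The transitions of the game simulating the counter machine `M`. -/
inductive Edge : GState C B → Fin 3 → GState C B → Prop
  | start {m : Mode B} (a : Fin 3) (hm : m ≠ .chg) : Edge none a (some (m, q₀))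
  | halt {q : C} (m : Mode B) (a : Fin 3) (h : M q = .halt) : Edge (some (m, q)) a none
  | pos {q : C} (i : Fin B) (a : Fin 3) (h : M q ≠ .halt) :
      Edge (some (.pos i, q)) a (some (.pos i, nxt M q a))
  | pos_exit {q : C} (i : Fin B) (a : Fin 3) (h : M q ≠ .halt) : Edge (some (.pos i, q)) a none
  | neg {q : C} (i : Fin B) (a : Fin 3) (h : M q ≠ .halt) :
      Edge (some (.neg i, q)) a (some (.neg i, nxt M q a))
  | neg_exit {q t z : C} (i : Fin B) (h : M q = .jzd i t z) : Edge (some (.neg i, q)) 2 none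
  | cnt {q : C} (a : Fin 3) (h : M q ≠ .halt) :
      Edge (some (.cnt, q)) a (some (.cnt, nxt M q a))
  | cnt_chg {q : C} (h : M q ≠ .halt) : Edge (some (.cnt, q)) 0 (some (.chg, q))
  | chg {q : C} (h : M q ≠ .halt) : Edge (some (.chg, q)) 0 (some (.chg, q))
  | chg_exit {q : C} (a : Fin 3) (h : M q ≠ .halt) : Edge (some (.chg, q)) a none

/-- The weights of the transitions, for the input `n`. -/
noncomputable def wt (n : ℕ) : GState C B → Fin 3 → GState C B → ℤ
  | none, _, some (.pos i, _) => input n i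
  | none, _, some (.neg i, _) => -input n i
  | none, _, _ => 0
  | some (m, q), a, y =>
      if M q = .halt then -1 else
      match m with
      | .pos i => change M q a i
      | .neg i => if y = none then 0 else -change M q a i
      | .cnt => match y with
        | some (.chg, _) => -1
        | _ => if a = 0 then 0 else 2
      | .chg => if a = 0 then -1 else 0

lemma exists_edge (x : GState C B) (a : Fin 3) : ∃ y, Edge M q₀ x a y := by
  obtain _ | ⟨m, q⟩ := x
  · exact ⟨_, .start (m := .cnt) a (by simp)⟩
  · by_cases h : M q = .halt
    · exact ⟨_, .halt m a h⟩
    · cases m with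
      | pos i => exact ⟨_, .pos i a h⟩
      | neg i => exact ⟨_, .neg i a h⟩
      | cnt => exact ⟨_, .cnt a h⟩
      | chg => exact ⟨_, .chg_exit a h⟩

lemma nxt_zero (q : C) : nxt M q 0 = q := by
  unfold nxt; split <;> simp

lemma change_zero (q : C) (i : ℕ) : change M q 0 i = 0 := by
  unfold change; split <;> simp

/-- The action `a` is not idle and makes no wrong claim in the configuration `x`. -/
def Correct (x : C × (ℕ → ℕ)) (a : Fin 3) : Prop :=
  a ≠ 0 ∧ ∀ r t z, M x.1 = .jzd r t z → (a = 2 ↔ x.2 r = 0)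

variable {M}

lemma Correct.nxt_eq {x : C × (ℕ → ℕ)} {a : Fin 3} (h : Correct M x a) :
    nxt M x.1 a = (step M x).1 := by
  obtain ⟨h0, h⟩ := h
  unfold nxt step
  split
  · rfl
  · simp [h0]
  · rename_i r t z hM
    have := h r t z hM
    have h3 : a = 1 ∨ a = 2 := by omega
    rcases h3 with rfl | rfl
    · rw [if_neg (by simp), if_pos rfl, if_neg (by simpa using this)]
    · rw [if_neg (by simp), if_neg (by simp), if_pos (by simpa using this)]

lemma Correct.change_eq {x : C × (ℕ → ℕ)} {a : Fin 3} (h : Correct M x a) (i : ℕ) :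
    x.2 i + change M x.1 a i = (step M x).2 i := by
  obtain ⟨h0, h⟩ := h
  unfold change step
  split
  · simp
  · rename_i r t hM
    by_cases hr : r = i
    · subst hr; simp [h0]
    · simp [hr, Function.update_of_ne (Ne.symm hr)]
  · rename_i r t z hM
    have := h r t z hM
    have h3 : a = 1 ∨ a = 2 := by omega
    rcases h3 with rfl | rfl
    · have hx : x.2 r ≠ 0 := by simpa using this
      rw [if_neg hx]
      by_cases hr : r = i
      · subst hr
        simp
        omega
      · simp [hr, Function.update_of_ne (Ne.symm hr)]
    · rw [if_pos (show x.2 r = 0 by simpa using this)]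
      simp

variable (M)

lemma exists_correct (x : C × (ℕ → ℕ)) : ∃ a, Correct M x a := by
  by_cases h : ∃ r t z, M x.1 = .jzd r t z ∧ x.2 r = 0
  · obtain ⟨r, t, z, hM, hr⟩ := h
    refine ⟨2, by simp, fun r' t' z' h' => ?_⟩
    obtain ⟨rfl, -, -⟩ := Instr.jzd.inj (hM.symm.trans h')
    simpa using hr
  · refine ⟨1, by simp, fun r t z hM => ?_⟩
    simpa using fun hr => h ⟨r, t, z, hM, hr⟩

/-- The configuration of the machine after `k` steps on the input `n`. -/
def conf (n k : ℕ) : C × (ℕ → ℕ) := (step M)^[k] (q₀, input n)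

lemma conf_succ (n k : ℕ) : conf M q₀ n (k + 1) = step M (conf M q₀ n k) :=
  Function.iterate_succ_apply' _ _ _

lemma conf_le (n k i : ℕ) : (conf M q₀ n k).2 i ≤ n + 1 + k := by
  induction k with
  | zero =>
    simp only [conf, input, Function.iterate_zero, id]
    split_ifs <;> omega
  | succ k ih =>
    obtain ⟨a, ha⟩ := exists_correct M (conf M q₀ n k)
    have h := ha.change_eq i
    rw [← conf_succ] at h
    have : change M (conf M q₀ n k).1 a i ≤ 1 := by
      unfold change
      split
      · simp
      · split_ifs <;> simp
      · split_ifs <;> simp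
    omega

/-- Eve's action after `j` steps in a round: she simulates a step of the machine exactly when
`j + 1` is a square, and stays idle otherwise. -/
noncomputable def eveAction (n j : ℕ) : Fin 3 :=
  if Nat.sqrt (j + 1) = Nat.sqrt j then 0
  else (exists_correct M (conf M q₀ n (Nat.sqrt j))).choose

/-- A lower bound for the weight of a play that is in mode `m` after `j` steps in a round
against Eve's strategy. -/
def eveBound (n j : ℕ) : Mode B → ℤ
  | .pos i => (conf M q₀ n (Nat.sqrt j)).2 i
  | .neg i => -(conf M q₀ n (Nat.sqrt j)).2 i
  | .cnt => 2 * Nat.sqrt j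
  | .chg => (Nat.sqrt j + 1) ^ 2 - 1 - j

/-- The state `x` and the weight `S` are possible after `j` steps in a round against Eve's
strategy. -/
def EveInv (n j : ℕ) (x : GState C B) (S : ℤ) : Prop :=
  match x with
  | none => 0 ≤ S
  | some (m, q) => q = (conf M q₀ n (Nat.sqrt j)).1 ∧ eveBound M q₀ n j m ≤ S

lemma le_of_eveInv {n j : ℕ} {x : GState C B} {S : ℤ} (h : EveInv M q₀ n j x S) :
    -((n : ℤ) + 1 + Nat.sqrt j) ≤ S := by
  obtain _ | ⟨m, q⟩ := x
  · simp only [EveInv] at h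
    omega
  · have h2 := h.2
    refine le_trans ?_ h2
    cases m with
    | pos i => simp only [eveBound]; omega
    | neg i =>
      have := conf_le M q₀ n (Nat.sqrt j) i
      simp only [eveBound]
      omega
    | cnt => simp only [eveBound]; omega
    | chg =>
      have : j < (Nat.sqrt j + 1) ^ 2 := Nat.lt_succ_sqrt' j
      zify at this
      simp only [eveBound]
      omega

variable {q₀}

lemma eveInv_start {n : ℕ} {a : Fin 3} {y : GState C B} {S : ℤ} (h : Edge M q₀ none a y)
    (hS : 0 ≤ S) : EveInv M q₀ n 0 y (S + wt M n none a y) := by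
  cases h with
  | @start m _ hm =>
    refine ⟨rfl, ?_⟩
    cases m with
    | pos i => simp [eveBound, wt, conf, hS]
    | neg i => simp [eveBound, wt, conf, hS]
    | cnt => simp [eveBound, wt, hS]
    | chg => exact absurd rfl hm

lemma sqrt_succ_cases (j : ℕ) : Nat.sqrt (j + 1) = Nat.sqrt j ∨
    Nat.sqrt (j + 1) = Nat.sqrt j + 1 ∧ j + 1 = (Nat.sqrt j + 1) ^ 2 := by
  have h1 := Nat.sqrt_succ_le_succ_sqrt j
  have h2 := Nat.sqrt_le_sqrt (Nat.le_succ j)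
  have h3 : j < (Nat.sqrt j + 1) ^ 2 := Nat.lt_succ_sqrt' j
  have h4 : (Nat.sqrt (j + 1)) ^ 2 ≤ j + 1 := Nat.sqrt_le' (j + 1)
  rcases Nat.lt_or_ge (Nat.sqrt j) (Nat.sqrt (j + 1)) with h | h
  · have h5 : Nat.sqrt (j + 1) = Nat.sqrt j + 1 := by
      simp only [Nat.succ_eq_add_one] at h1
      omega
    rw [h5] at h4
    exact .inr ⟨h5, by omega⟩
  · simp only [Nat.succ_eq_add_one] at h2
    exact .inl (by omega)

lemma eveInv_step {n : ℕ} (hn : ¬ HaltsFrom M (q₀, input n)) {j : ℕ} {p : Mode B × C}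
    {y : GState C B} {S : ℤ} (hp : EveInv M q₀ n j (some p) S)
    (h : Edge M q₀ (some p) (eveAction M q₀ n j) y) :
    EveInv M q₀ n (j + 1) y (S + wt M n (some p) (eveAction M q₀ n j) y) := by
  obtain ⟨m, q⟩ := p
  obtain ⟨rfl, hS⟩ := hp
  have hM : M (conf M q₀ n (Nat.sqrt j)).1 ≠ .halt := fun h => hn ⟨_, h⟩
  have hj : j < (Nat.sqrt j + 1) ^ 2 := Nat.lt_succ_sqrt' j
  have hj' : Nat.sqrt j ^ 2 ≤ j := Nat.sqrt_le' j
  have hj'' : (Nat.sqrt j + 1) ^ 2 = Nat.sqrt j ^ 2 + 2 * Nat.sqrt j + 1 := by ring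
  rcases sqrt_succ_cases j with hs | ⟨hs, hsq⟩
  · have ha : eveAction M q₀ n j = 0 := if_pos hs
    have hlt : j + 1 < (Nat.sqrt j + 1) ^ 2 := by
      have := Nat.lt_succ_sqrt' (j + 1)
      rwa [hs] at this
    generalize hq : (conf M q₀ n (Nat.sqrt j)).1 = q at *
    rw [ha] at h ⊢
    zify at hlt hj' hj''
    cases h with
    | halt m a h => exact absurd h hM
    | pos i a h =>
      refine ⟨by rw [hs, hq, nxt_zero], ?_⟩
      simpa [eveBound, wt, hM, hs, change_zero] using hS
    | pos_exit i a h =>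
      simp only [eveBound] at hS
      simp only [EveInv, wt, hM, if_false, change_zero]
      omega
    | neg i a h =>
      refine ⟨by rw [hs, hq, nxt_zero], ?_⟩
      simpa [eveBound, wt, hM, hs, change_zero] using hS
    | cnt a h =>
      refine ⟨by rw [hs, hq, nxt_zero], ?_⟩
      simpa [eveBound, wt, hM, hs] using hS
    | cnt_chg h =>
      refine ⟨by rw [hs, hq], ?_⟩
      simp only [eveBound] at hS
      simp only [wt, hM, if_false, hs, eveBound]
      push_cast
      omega
    | chg h =>
      refine ⟨by rw [hs, hq], ?_⟩
      simp only [eveBound] at hS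
      simp only [wt, hM, if_false, if_true, hs, eveBound]
      push_cast
      omega
    | chg_exit a h =>
      simp only [eveBound] at hS
      simp only [EveInv, wt, hM, if_false, if_true]
      omega
  · have ha : Correct M (conf M q₀ n (Nat.sqrt j)) (eveAction M q₀ n j) := by
      rw [eveAction, if_neg (by omega)]
      exact (exists_correct M _).choose_spec
    have hnx := ha.nxt_eq
    have hch := ha.change_eq
    have h0 := ha.1
    rw [← conf_succ, ← hs] at hnx
    simp_rw [← conf_succ, ← hs] at hch
    generalize eveAction M q₀ n j = a at *
    have hc2 := ha.2
    generalize hcf : conf M q₀ n (Nat.sqrt j) = cf at *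
    obtain ⟨q, c⟩ := cf
    simp only at *
    zify at hj hj' hj'' hsq
    cases h with
    | halt m a h => exact absurd h hM
    | pos i a h =>
      refine ⟨hnx, ?_⟩
      have := hch i
      simp only [eveBound, hcf] at hS
      simp only [wt, hM, if_false, eveBound]
      omega
    | pos_exit i a h =>
      have := hch i
      simp only [eveBound, hcf] at hS
      simp only [EveInv, wt, hM, if_false]
      omega
    | neg i a h =>
      refine ⟨hnx, ?_⟩
      have := hch i
      simp only [eveBound, hcf] at hS
      simp only [wt, hM, if_false, eveBound, reduceCtorEq]
      omega
    | neg_exit i h =>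
      have := (hc2 _ _ _ h).1 rfl
      simp only [eveBound, hcf] at hS
      simp only [EveInv, wt, hM, if_false, if_true]
      omega
    | cnt a h =>
      refine ⟨hnx, ?_⟩
      simp only [eveBound] at hS
      simp only [wt, hM, if_false, h0, eveBound, hs]
      push_cast
      omega
    | cnt_chg h => exact absurd rfl h0
    | chg h => exact absurd rfl h0
    | chg_exit a h =>
      simp only [eveBound] at hS
      simp only [EveInv, wt, hM, if_false, h0]
      omega

variable (q₀)

/-- Paths through a single round, from the initial state to a state other than it. -/
inductive Run (n : ℕ) (u : ℕ → Fin 3) : ℕ → Mode B × C → ℤ → Prop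
  | start {y : Mode B × C} (h : Edge M q₀ none (u 0) (some y)) :
      Run n u 1 y (wt M n none (u 0) (some y))
  | step {t : ℕ} {x y : Mode B × C} {S : ℤ} (hx : Run n u t x S)
      (h : Edge M q₀ (some x) (u t) (some y)) :
      Run n u (t + 1) y (S + wt M n (some x) (u t) (some y))

/-- A round of `t + 1` steps with negative total weight is possible. -/
def LosingRound (B : ℕ) (n : ℕ) (u : ℕ → Fin 3) (t : ℕ) : Prop :=
  ∃ (y : Mode B × C) (S : ℤ), Run M q₀ n u t y S ∧ Edge M q₀ (some y) (u t) none ∧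
    S + wt M n (some y) (u t) none ≤ -1

/-- The actions `u` correctly simulate `k` steps of the machine before the step `j`, and are
idle in the last `d` of these steps. -/
structure Honest (B : ℕ) (n : ℕ) (u : ℕ → Fin 3) (j k d : ℕ) : Prop where
  le : j ≤ k ^ 2 + d
  pos (i : Fin B) : Run M q₀ n u (j + 1) (.pos i, (conf M q₀ n k).1) ((conf M q₀ n k).2 i)
  neg (i : Fin B) : Run M q₀ n u (j + 1) (.neg i, (conf M q₀ n k).1) (-(conf M q₀ n k).2 i)
  cnt : Run (B := B) M q₀ n u (j + 1) (.cnt, (conf M q₀ n k).1) (2 * k)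
  chg : 0 < d → Run (B := B) M q₀ n u (j + 1) (.chg, (conf M q₀ n k).1) (2 * k - d)

variable {M q₀}

lemma Run.congr {n : ℕ} {u : ℕ → Fin 3} {t : ℕ} {x y : Mode B × C} {S S' : ℤ}
    (h : Run M q₀ n u t x S) (hx : x = y) (hS : S = S') : Run M q₀ n u t y S' := by
  rwa [← hx, ← hS]

lemma honest_zero (n : ℕ) (u : ℕ → Fin 3) : Honest M q₀ B n u 0 0 0 where
  le := by simp
  pos i := .start (.start _ (by simp))
  neg i := .start (.start _ (by simp))
  cnt := .start (.start _ (by simp))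
  chg := by simp

lemma Honest.losingRound {n : ℕ} {u : ℕ → Fin 3} {j k d : ℕ} (h : Honest M q₀ B n u j k d)
    (hB : 0 < B) (hd : M (conf M q₀ n k).1 = .halt ∨ 2 * k < d) :
    LosingRound M q₀ B n u (j + 1) := by
  by_cases hM : M (conf M q₀ n k).1 = .halt
  · refine ⟨_, _, h.neg ⟨0, hB⟩, .halt _ _ hM, ?_⟩
    simp only [wt, hM, if_true]
    omega
  · have hd : 2 * k < d := by tauto
    refine ⟨_, _, h.chg (by omega), .chg_exit _ hM, ?_⟩
    simp only [wt, hM, if_false]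
    split_ifs <;> omega

lemma Honest.step {n : ℕ} {u : ℕ → Fin 3} {j k d : ℕ} (h : Honest M q₀ B n u j k d)
    (hB : ∀ q r t z, M q = .jzd r t z → r < B) (hM : M (conf M q₀ n k).1 ≠ .halt)
    (hd : d ≤ 2 * k) :
    LosingRound M q₀ B n u (j + 1) ∨ ∃ k' d', Honest M q₀ B n u (j + 1) k' d' := by
  by_cases h0 : u (j + 1) = 0
  · refine .inr ⟨k, d + 1, ?_, ?_, ?_, ?_, ?_⟩
    · have := h.le
      omega
    · intro i
      refine ((h.pos i).step (.pos i _ hM)).congr (by rw [h0, nxt_zero]) ?_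
      simp [wt, hM, h0, change_zero]
    · intro i
      refine ((h.neg i).step (.neg i _ hM)).congr (by rw [h0, nxt_zero]) ?_
      simp [wt, hM, h0, change_zero]
    · refine (h.cnt.step (.cnt _ hM)).congr (by rw [h0, nxt_zero]) ?_
      simp [wt, hM, h0]
    · intro _
      rcases Nat.eq_zero_or_pos d with rfl | hd0
      · refine (h.cnt.step (by rw [h0]; exact .cnt_chg hM)).congr rfl ?_
        simp [wt, hM]
        ring
      · refine ((h.chg hd0).step (by rw [h0]; exact .chg hM)).congr rfl ?_
        simp [wt, hM, h0]
        ring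
  · by_cases hc : Correct M (conf M q₀ n k) (u (j + 1))
    · refine .inr ⟨k + 1, 0, ?_, ?_, ?_, ?_, by simp⟩
      · have := h.le
        have : (k + 1) ^ 2 = k ^ 2 + 2 * k + 1 := by ring
        omega
      · intro i
        refine ((h.pos i).step (.pos i _ hM)).congr (by rw [hc.nxt_eq, conf_succ]) ?_
        rw [conf_succ, ← hc.change_eq]
        simp [wt, hM]
      · intro i
        refine ((h.neg i).step (.neg i _ hM)).congr (by rw [hc.nxt_eq, conf_succ]) ?_
        rw [conf_succ, ← hc.change_eq]
        simp [wt, hM]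
        ring
      · refine (h.cnt.step (.cnt _ hM)).congr (by rw [hc.nxt_eq, conf_succ]) ?_
        simp [wt, hM, h0]
        ring
    · left
      simp only [Correct, ne_eq, h0, not_false_eq_true, true_and, not_forall] at hc
      obtain ⟨r, t, z, hq, hr⟩ := hc
      have hrB := hB _ _ _ _ hq
      have h3 : u (j + 1) = 1 ∨ u (j + 1) = 2 := by omega
      rcases h3 with h1 | h2
      · refine ⟨_, _, h.pos ⟨r, hrB⟩, .pos_exit _ _ hM, ?_⟩
        simp only [h1] at hr
        have hr : (conf M q₀ n k).2 r = 0 := by simpa using hr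
        simp [wt, hq, change, h1, hr]
      · refine ⟨_, _, h.neg ⟨r, hrB⟩, by rw [h2]; exact .neg_exit ⟨r, hrB⟩ hq, ?_⟩
        have hr : (conf M q₀ n k).2 r ≠ 0 := by simpa [h2] using hr
        simp only [wt, hM, if_false, if_true]
        omega

theorem exists_losingRound (hB : 0 < B) (hB' : ∀ q r t z, M q = .jzd r t z → r < B) {n : ℕ}
    (hn : HaltsFrom M (q₀, input n)) :
    ∃ D, ∀ u : ℕ → Fin 3, ∃ t ≤ D, LosingRound M q₀ B n u t := by
  obtain ⟨N, hN⟩ := hn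
  refine ⟨N ^ 2 + 2 * N + 2, fun u => ?_⟩
  by_contra! hne
  have key : ∀ j ≤ N ^ 2 + 2 * N + 1, ∃ k d, Honest M q₀ B n u j k d := by
    intro j hj
    induction j with
    | zero => exact ⟨0, 0, honest_zero n u⟩
    | succ j ih =>
      obtain ⟨k, d, h⟩ := ih (by omega)
      have hl := hne (j + 1) (by omega)
      have : ¬(M (conf M q₀ n k).1 = .halt ∨ 2 * k < d) := fun h' => hl (h.losingRound hB h')
      rw [not_or, not_lt] at this
      exact (h.step hB' this.1 this.2).resolve_left hl
  obtain ⟨k, d, h⟩ := key _ le_rfl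
  have : ¬(M (conf M q₀ n k).1 = .halt ∨ 2 * k < d) :=
    fun h' => hne _ (by omega) (h.losingRound hB h')
  rw [not_or, not_lt] at this
  obtain ⟨hM, hd⟩ := this
  have hk : k < N := by
    by_contra! hk
    obtain ⟨e, rfl⟩ := Nat.exists_eq_add_of_le' hk
    refine hM ?_
    rw [conf, Function.iterate_add_apply, iterate_step_of_halt hN]
    exact hN
  have := h.le
  have : k ^ 2 ≤ N ^ 2 := Nat.pow_le_pow_left hk.le 2
  omega

end Game

section Play

variable {C : Type} {B : ℕ} {M : C → Instr C} {q₀ : C}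

/-- The actions chosen by `σ` along a sequence of states are determined by the visits to the
initial state so far. -/
def ObservationBased (σ : (ℕ → GState C B) → ℕ → Fin 3) : Prop :=
  ∀ x x' t, (∀ i ≤ t, x i = none ↔ x' i = none) → σ x t = σ x' t

/-- The total weight of the first `t` transitions. -/
noncomputable def weight (M : C → Instr C) (n : ℕ) (σ : (ℕ → GState C B) → ℕ → Fin 3)
    (x : ℕ → GState C B) (t : ℕ) : ℤ :=
  ∑ i ∈ Finset.range t, wt M n (x i) (σ x i) (x (i + 1))

/-- The first `T` transitions form a play against `σ` that returns to the initial state. -/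
structure PlayTo (M : C → Instr C) (q₀ : C) (σ : (ℕ → GState C B) → ℕ → Fin 3)
    (x : ℕ → GState C B) (T : ℕ) : Prop where
  start : x 0 = none
  edge : ∀ t < T, Edge M q₀ (x t) (σ x t) (x (t + 1))
  eq_none : x T = none

lemma weight_congr {n : ℕ} {σ : (ℕ → GState C B) → ℕ → Fin 3} (hσ : ObservationBased σ)
    {x x' : ℕ → GState C B} {t : ℕ} (h : ∀ i ≤ t, x i = x' i) :
    weight M n σ x t = weight M n σ x' t := by
  refine Finset.sum_congr rfl fun i hi => ?_
  rw [Finset.mem_range] at hi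
  rw [h i hi.le, h (i + 1) hi, hσ x x' i fun j hj => by rw [h j (by omega)]]

lemma edge_congr {σ : (ℕ → GState C B) → ℕ → Fin 3} (hσ : ObservationBased σ)
    {x x' : ℕ → GState C B} {t : ℕ} (h : ∀ i ≤ t + 1, x i = x' i)
    (he : Edge M q₀ (x t) (σ x t) (x (t + 1))) : Edge M q₀ (x' t) (σ x' t) (x' (t + 1)) := by
  rwa [← h t (by omega), ← h (t + 1) le_rfl,
    ← hσ x x' t fun j hj => by rw [h j (by omega)]]

lemma Run.exists_play {n : ℕ} {σ : (ℕ → GState C B) → ℕ → Fin 3} (hσ : ObservationBased σ)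
    {x v : ℕ → GState C B} {T : ℕ} (hx : PlayTo M q₀ σ x T) (hv : ∀ i ≤ T, v i = x i)
    (hv' : ∀ i > T, v i ≠ none) {t : ℕ} {y : Mode B × C} {S : ℤ}
    (h : Run M q₀ n (fun i => σ v (T + i)) t y S) :
    ∃ x' : ℕ → GState C B, (∀ i ≤ T, x' i = x i) ∧ (∀ i > T, x' i ≠ none) ∧
      x' (T + t) = some y ∧ (∀ i < T + t, Edge M q₀ (x' i) (σ x' i) (x' (i + 1))) ∧
      weight M n σ x' (T + t) = weight M n σ x T + S := by
  have hpat : ∀ x' : ℕ → GState C B, (∀ i ≤ T, x' i = x i) → (∀ i > T, x' i ≠ none) →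
      ∀ i, σ x' i = σ v i := by
    intro x' h₁ h₂ i
    refine hσ _ _ _ fun j _ => ?_
    rcases le_or_gt j T with hj | hj
    · rw [h₁ j hj, hv j hj]
    · simp [h₂ j hj, hv' j hj]
  induction h with
  | @start y h =>
    let x' : ℕ → GState C B := fun i => if i ≤ T then x i else some y
    have h₁ : ∀ i ≤ T, x' i = x i := fun i hi => if_pos hi
    have h₂ : ∀ i > T, x' i = some y := fun i hi => if_neg (by omega)
    have hσ' := hpat x' h₁ fun i hi => by simp [h₂ i hi]
    refine ⟨x', h₁, fun i hi => by simp [h₂ i hi], h₂ _ (by omega), fun i hi => ?_, ?_⟩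
    · rcases Nat.lt_or_ge i T with hi' | hi'
      · exact edge_congr hσ (fun j hj => (h₁ j (by omega)).symm) (hx.edge i hi')
      · obtain rfl : i = T := by omega
        rw [h₁ i le_rfl, h₂ _ (by omega), hx.eq_none, hσ']
        exact h
    · rw [weight, Finset.sum_range_succ, ← weight, weight_congr hσ h₁, h₁ T le_rfl,
        h₂ _ (by omega), hx.eq_none, hσ']
      rfl
  | @step t y z S _ h ih =>
    obtain ⟨x', h₁, h₂, h₃, h₄, h₅⟩ := ih
    let x'' : ℕ → GState C B := fun i => if i ≤ T + t then x' i else some z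
    have h₁' : ∀ i ≤ T + t, x'' i = x' i := fun i hi => if_pos hi
    have h₂' : ∀ i > T + t, x'' i = some z := fun i hi => if_neg (by omega)
    have g₁ : ∀ i ≤ T, x'' i = x i := fun i hi => by rw [h₁' i (by omega), h₁ i hi]
    have g₂ : ∀ i > T, x'' i ≠ none := by
      intro i hi
      rcases le_or_gt i (T + t) with hi' | hi'
      · rw [h₁' i hi']
        exact h₂ i hi
      · simp [h₂' i hi']
    have hσ' := hpat x'' g₁ g₂
    refine ⟨x'', g₁, g₂, h₂' _ (by omega), fun i hi => ?_, ?_⟩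
    · rcases Nat.lt_or_ge i (T + t) with hi' | hi'
      · exact edge_congr hσ (fun j hj => (h₁' j (by omega)).symm) (h₄ i hi')
      · obtain rfl : i = T + t := by omega
        rw [h₁' _ le_rfl, h₂' _ (by omega), h₃, hσ']
        exact h
    · rw [← add_assoc T t 1, weight, Finset.sum_range_succ, ← weight, weight_congr hσ h₁',
        h₁' _ le_rfl, h₂' _ (by omega), h₃, hσ', h₅, add_assoc]

lemma PlayTo.extend {n D : ℕ} {σ : (ℕ → GState C B) → ℕ → Fin 3} (hσ : ObservationBased σ)
    (hD : ∀ u : ℕ → Fin 3, ∃ t ≤ D, LosingRound M q₀ B n u t)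
    {x : ℕ → GState C B} {T : ℕ} (hx : PlayTo M q₀ σ x T) :
    ∃ x' T', PlayTo M q₀ σ x' T' ∧ T < T' ∧ T' ≤ T + (D + 1) ∧ (∀ i ≤ T, x' i = x i) ∧
      weight M n σ x' T' ≤ weight M n σ x T - 1 := by
  let v : ℕ → GState C B := fun i => if i ≤ T then x i else some (.cnt, q₀)
  have hv : ∀ i ≤ T, v i = x i := fun i hi => if_pos hi
  have hv' : ∀ i > T, v i = some (.cnt, q₀) := fun i hi => if_neg (by omega)
  have hv'' : ∀ i > T, v i ≠ none := fun i hi => by simp [hv' i hi]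
  obtain ⟨t, ht, y, S, hrun, hedge, hS⟩ := hD fun i => σ v (T + i)
  obtain ⟨x', h₁, h₂, h₃, h₄, h₅⟩ := hrun.exists_play hσ hx hv hv''
  have hσ' : σ x' (T + t) = σ v (T + t) := by
    refine hσ _ _ _ fun j _ => ?_
    rcases le_or_gt j T with hj | hj
    · rw [h₁ j hj, hv j hj]
    · simp [h₂ j hj, hv'' j hj]
  let z : ℕ → GState C B := fun i => if i ≤ T + t then x' i else none
  have hz : ∀ i ≤ T + t, z i = x' i := fun i hi => if_pos hi
  have hz' : z (T + t + 1) = none := if_neg (by omega)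
  have hσz : σ z (T + t) = σ v (T + t) := by
    rw [← hσ']
    exact hσ _ _ _ fun j hj => by rw [hz j hj]
  refine ⟨z, T + t + 1, ⟨?_, ?_, hz'⟩, by omega, by omega,
    fun i hi => by rw [hz i (by omega), h₁ i hi], ?_⟩
  · rw [hz 0 (by omega), h₁ 0 (by omega), hx.start]
  · intro i hi
    rcases Nat.lt_or_ge i (T + t) with hi' | hi'
    · exact edge_congr hσ (fun j hj => (hz j (by omega)).symm) (h₄ i hi')
    · obtain rfl : i = T + t := by omega
      rw [hz _ le_rfl, hz', h₃, hσz]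
      exact hedge
  · rw [weight, Finset.sum_range_succ, ← weight, weight_congr hσ hz, h₅, hz _ le_rfl, hz', h₃, hσz]
    change S + wt M n (some y) (σ v (T + t)) none ≤ -1 at hS
    omega

theorem exists_losing_play {n D : ℕ} {σ : (ℕ → GState C B) → ℕ → Fin 3}
    (hσ : ObservationBased σ) (hD : ∀ u : ℕ → Fin 3, ∃ t ≤ D, LosingRound M q₀ B n u t) :
    ∃ x : ℕ → GState C B, x 0 = none ∧ (∀ t, Edge M q₀ (x t) (σ x t) (x (t + 1))) ∧
      ∀ k, ∃ t ≥ k, (D + 1) * weight M n σ x t ≤ -t := by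
  have hnext : ∀ p : {p : (ℕ → GState C B) × ℕ // PlayTo M q₀ σ p.1 p.2},
      ∃ p' : {p : (ℕ → GState C B) × ℕ // PlayTo M q₀ σ p.1 p.2},
        p.1.2 < p'.1.2 ∧ p'.1.2 ≤ p.1.2 + (D + 1) ∧ (∀ i ≤ p.1.2, p'.1.1 i = p.1.1 i) ∧
        weight M n σ p'.1.1 p'.1.2 ≤ weight M n σ p.1.1 p.1.2 - 1 := by
    rintro ⟨⟨x, T⟩, hx⟩
    obtain ⟨x', T', h, h'⟩ := hx.extend hσ hD
    exact ⟨⟨⟨x', T'⟩, h⟩, h'⟩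
  choose next hlt hle hagree hweight using hnext
  let P : ℕ → {p : (ℕ → GState C B) × ℕ // PlayTo M q₀ σ p.1 p.2} := fun k =>
    next^[k] ⟨⟨fun _ => none, 0⟩, rfl, by simp, rfl⟩
  have hP : ∀ k, P (k + 1) = next (P k) := fun k => Function.iterate_succ_apply' _ _ _
  have hge : ∀ k, k ≤ (P k).1.2 := by
    intro k
    induction k with
    | zero => exact le_rfl
    | succ k ih =>
      have := hlt (P k)
      rw [hP]
      omega
  have hub : ∀ k, (P k).1.2 ≤ (D + 1) * k := by
    intro k
    induction k with
    | zero => exact le_rfl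
    | succ k ih =>
      have := hle (P k)
      rw [hP, mul_add]
      omega
  have hw : ∀ k, weight M n σ (P k).1.1 (P k).1.2 ≤ -k := by
    intro k
    induction k with
    | zero => simp [P, weight]
    | succ k ih =>
      have := hweight (P k)
      rw [hP]
      push_cast
      omega
  have hag : ∀ k d, ∀ i ≤ (P k).1.2,
      (P (k + d)).1.1 i = (P k).1.1 i ∧ (P k).1.2 ≤ (P (k + d)).1.2 := by
    intro k d
    induction d with
    | zero => exact fun i _ => ⟨rfl, le_rfl⟩
    | succ d ih =>
      intro i hi
      obtain ⟨h₁, h₂⟩ := ih i hi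
      rw [← add_assoc, hP]
      exact ⟨by rw [hagree _ i (hi.trans h₂), h₁], h₂.trans (hlt _).le⟩
  let x : ℕ → GState C B := fun i => (P i).1.1 i
  have hx : ∀ k, ∀ i ≤ (P k).1.2, (P k).1.1 i = x i := by
    intro k i hi
    rcases le_total k i with h | h
    · obtain ⟨d, rfl⟩ := Nat.exists_eq_add_of_le h
      exact (hag k d _ hi).1.symm
    · obtain ⟨d, rfl⟩ := Nat.exists_eq_add_of_le h
      exact (hag i d i (hge i)).1
  refine ⟨x, rfl, fun t => ?_, fun k => ⟨(P k).1.2, hge k, ?_⟩⟩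
  · have := hge (t + 1)
    exact edge_congr hσ (fun i hi => hx (t + 1) i (by omega)) ((P (t + 1)).2.edge t (by omega))
  · rw [← weight_congr hσ (hx k)]
    have h₁ := hw k
    have h₂ := hub k
    zify at h₂
    nlinarith

end Play

section Simulation

open Filter

lemma exists_abs_w_le (G : MPG) : ∃ W : ℤ, ∀ q a q', |G.w q a q'| ≤ W := by
  have := G.fintypeQ
  have := G.fintypeA
  obtain ⟨W, hW⟩ := (Set.finite_range fun x : G.Q × G.A × G.Q => |G.w x.1 x.2.1 x.2.2|).bddAbove
  exact ⟨W, fun q a q' => hW ⟨(q, a, q'), rfl⟩⟩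

lemma exists_abs_div_le (G : MPG) (π : ℕ → G.Q × G.A) :
    ∃ W : ℝ, ∀ n : ℕ, |(G.sumW π n : ℝ) / n| ≤ W := by
  obtain ⟨W, hW⟩ := exists_abs_w_le G
  refine ⟨W, fun n => ?_⟩
  have h : |G.sumW π n| ≤ n * W := by
    refine (Finset.abs_sum_le_sum_abs _ _).trans ?_
    refine (Finset.sum_le_sum fun i _ => hW _ _ _).trans ?_
    simp
  rcases Nat.eq_zero_or_pos n with rfl | hn
  · have := (abs_nonneg _).trans (hW G.qI (π 0).2 G.qI)
    simpa using this
  · have hn' : (0 : ℝ) < n := by exact_mod_cast hn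
    rw [abs_div, Nat.abs_cast, div_le_iff₀ hn', mul_comm]
    exact_mod_cast h

lemma isBoundedUnder_ge (G : MPG) (π : ℕ → G.Q × G.A) :
    IsBoundedUnder (· ≥ ·) atTop fun n : ℕ => (G.sumW π n : ℝ) / n := by
  obtain ⟨W, hW⟩ := exists_abs_div_le G π
  exact isBoundedUnder_of ⟨-W, fun n => (abs_le.1 (hW n)).1⟩

lemma isBoundedUnder_le (G : MPG) (π : ℕ → G.Q × G.A) :
    IsBoundedUnder (· ≤ ·) atTop fun n : ℕ => (G.sumW π n : ℝ) / n := by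
  obtain ⟨W, hW⟩ := exists_abs_div_le G π
  exact isBoundedUnder_of ⟨W, fun n => (abs_le.1 (hW n)).2⟩

lemma mp_nonneg_of_le (G : MPG) (π : ℕ → G.Q × G.A) (n : ℕ)
    (h : ∀ t, -((n : ℤ) + 1 + Nat.sqrt t) ≤ G.sumW π t) : 0 ≤ G.MP π := by
  have hlim : Tendsto (fun t : ℕ => -((n + 1 : ℝ) / t + (√(t : ℝ))⁻¹)) atTop (nhds 0) := by
    have h1 : Tendsto (fun t : ℕ => (n + 1 : ℝ) / t) atTop (nhds 0) :=
      tendsto_const_div_atTop_nhds_zero_nat _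
    have h2 : Tendsto (fun t : ℕ => (√(t : ℝ))⁻¹) atTop (nhds 0) :=
      (Real.tendsto_sqrt_atTop.comp tendsto_natCast_atTop_atTop).inv_tendsto_atTop
    simpa using (h1.add h2).neg
  rw [← hlim.liminf_eq]
  refine liminf_le_liminf ?_ hlim.isBoundedUnder_ge (isBoundedUnder_le G π).isCoboundedUnder_ge
  filter_upwards [eventually_gt_atTop 0] with t ht
  have ht' : (0 : ℝ) < t := by exact_mod_cast ht
  have h1 : -((n : ℝ) + 1 + Nat.sqrt t) ≤ G.sumW π t := by exact_mod_cast h t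
  have h2 : (Nat.sqrt t : ℝ) ≤ √(t : ℝ) := Real.nat_sqrt_le_real_sqrt
  rw [le_div_iff₀ ht']
  have h3 : (√(t : ℝ))⁻¹ * t = √(t : ℝ) := by
    rw [inv_mul_eq_div, Real.div_sqrt]
  have h4 : (n + 1 : ℝ) / t * t = n + 1 := div_mul_cancel₀ _ ht'.ne'
  rw [neg_mul, add_mul, h3, h4]
  linarith

lemma mp_neg_of_le (G : MPG) (π : ℕ → G.Q × G.A) (D : ℕ)
    (h : ∀ k, ∃ t ≥ k, (D + 1) * G.sumW π t ≤ -t) : G.MP π < 0 := by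
  refine lt_of_le_of_lt (liminf_le_of_frequently_le (a := -((D : ℝ) + 1)⁻¹) ?_
    (isBoundedUnder_ge G π)) (by
      rw [neg_lt_zero]
      positivity)
  rw [frequently_atTop]
  intro k
  obtain ⟨t, ht, hw⟩ := h (k + 1)
  refine ⟨t, by omega, ?_⟩
  have ht' : (0 : ℝ) < t := by
    have : 0 < t := by omega
    exact_mod_cast this
  have hw' : ((D : ℝ) + 1) * G.sumW π t ≤ -t := by exact_mod_cast hw
  have hD : (0 : ℝ) < (D : ℝ) + 1 := by positivity
  have h1 := mul_le_mul_of_nonneg_left hw' (inv_nonneg.2 hD.le)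
  rw [inv_mul_cancel_left₀ hD.ne'] at h1
  rw [div_le_iff₀ ht']
  linarith

variable {C : Type} {B : ℕ} {M : C → Instr C} {q₀ : C}

/-- The game `G` is, up to renaming states and actions, the game simulating `M` on the input
`n`. -/
structure Simulates (M : C → Instr C) (q₀ : C) (n : ℕ) (G : MPG) (e : GState C B ≃ G.Q)
    (f : Fin 3 ≃ G.A) : Prop where
  qI : G.qI = e none
  delta : ∀ x a y, G.delta (e x) (f a) (e y) ↔ Edge M q₀ x a y
  w : ∀ x a y, Edge M q₀ x a y → G.w (e x) (f a) (e y) = wt M n x a y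
  obs : G.Obs = {{e none}, {e none}ᶜ}

theorem Simulates.exists_eveWinningStrategy {n : ℕ} {G : MPG} {e : GState C B ≃ G.Q}
    {f : Fin 3 ≃ G.A} (hG : Simulates M q₀ n G e f) (hn : ¬ HaltsFrom M (q₀, input n)) :
    ∃ st, G.EveWinningStrategy st := by
  let cnt : List (Set G.Q × G.A) → ℕ :=
    List.foldl (fun k p => if p.1 = {e none} then 0 else k + 1) 0
  refine ⟨fun h _ => f (eveAction M q₀ n (cnt h)), fun ψ hψ hcons π hπ => ?_⟩
  let x : ℕ → GState C B := fun t => e.symm (π t).1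
  have hxe : ∀ t, (π t).1 = e (x t) := fun t => (e.apply_symm_apply _).symm
  have hobs : ∀ t, (ψ t).1 = {e none} ↔ x t = none := by
    intro t
    have h₁ := hψ.1.1 t
    have h₂ := (hπ.2 t).1
    rw [hG.obs] at h₁
    rw [hxe] at h₂
    constructor
    · intro h
      rw [h] at h₂
      exact e.injective h₂
    · intro h
      rcases h₁ with h₁ | h₁
      · exact h₁
      · rw [h₁, h] at h₂
        exact absurd rfl h₂
  have hcnt : ∀ t, cnt (G.hist ψ (t + 1)) = if x t = none then 0 else cnt (G.hist ψ t) + 1 := by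
    intro t
    simp [cnt, MPG.hist, List.range_succ, hobs]
  have hact : ∀ t, (π t).2 = f (eveAction M q₀ n (cnt (G.hist ψ t))) := by
    intro t
    rw [(hπ.2 t).2, hcons t]
  have hedge : ∀ t, Edge M q₀ (x t) (eveAction M q₀ n (cnt (G.hist ψ t))) (x (t + 1)) := by
    intro t
    have := hπ.1 t
    rwa [hxe t, hxe (t + 1), hact t, hG.delta] at this
  have hinv : ∀ t, cnt (G.hist ψ t) ≤ t ∧ EveInv M q₀ n (cnt (G.hist ψ t)) (x t) (G.sumW π t) := by
    intro t
    induction t with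
    | zero =>
      refine ⟨le_rfl, ?_⟩
      have h0 := hψ.2
      have : x 0 = none := by
        rw [← hobs]
        rcases hG.obs ▸ hψ.1.1 0 with h₁ | h₁
        · exact h₁
        · rw [h₁, hG.qI] at h0
          exact absurd rfl h0
      rw [this]
      exact le_rfl
    | succ t ih =>
      obtain ⟨ih₁, ih₂⟩ := ih
      have he := hedge t
      have hsum : G.sumW π (t + 1) = G.sumW π t +
          wt M n (x t) (eveAction M q₀ n (cnt (G.hist ψ t))) (x (t + 1)) := by
        rw [MPG.sumW, Finset.sum_range_succ, ← MPG.sumW, hxe t, hxe (t + 1), hact t, hG.w _ _ _ he]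
      rw [hsum, hcnt]
      rcases hx : x t with _ | p
      · rw [hx] at he ih₂
        exact ⟨by simp, eveInv_start M he ih₂⟩
      · rw [hx] at he ih₂
        exact ⟨by simpa using ih₁, eveInv_step M hn ih₂ he⟩
  refine mp_nonneg_of_le G π n fun t => ?_
  have h₁ := le_of_eveInv M q₀ (hinv t).2
  have h₂ := Nat.sqrt_le_sqrt (hinv t).1
  omega

theorem Simulates.not_eveWinningStrategy {n : ℕ} {G : MPG} {e : GState C B ≃ G.Q}
    {f : Fin 3 ≃ G.A} (hG : Simulates M q₀ n G e f) (hB : 0 < B)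
    (hB' : ∀ q r t z, M q = .jzd r t z → r < B) (hn : HaltsFrom M (q₀, input n))
    (st : G.EveStrategy) : ¬ G.EveWinningStrategy st := by
  let obs : GState C B → Set G.Q := fun x => if x = none then {e none} else {e none}ᶜ
  let H : (ℕ → GState C B) → ℕ → List (Set G.Q × G.A) := fun x t =>
    Nat.rec [] (fun i h => h ++ [(obs (x i), st h (obs (x i)))]) t
  let ψ : (ℕ → GState C B) → ℕ → Set G.Q × G.A := fun x t =>
    (obs (x t), st (H x t) (obs (x t)))
  have hH : ∀ x t, H x (t + 1) = H x t ++ [ψ x t] := fun x t => rfl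
  have hψ : ∀ x t, G.hist (ψ x) t = H x t := by
    intro x t
    induction t with
    | zero => rfl
    | succ t ih => rw [hH, ← ih, MPG.hist, MPG.hist, List.range_succ, List.map_append]; rfl
  have hσ : ObservationBased fun x t => f.symm (ψ x t).2 := by
    intro x x' t h
    have ho : ∀ i ≤ t, obs (x i) = obs (x' i) := fun i hi => by simp only [obs, h i hi]
    have hH' : ∀ i ≤ t, H x i = H x' i := by
      intro i hi
      induction i with
      | zero => rfl
      | succ i ih =>
        simp only [hH, ψ]
        rw [ih (by omega), ho i (by omega)]
    simp only [ψ]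
    rw [hH' t le_rfl, ho t le_rfl]
  obtain ⟨D, hD⟩ := exists_losingRound hB hB' hn
  obtain ⟨x, hx0, hedge, hx⟩ := exists_losing_play hσ hD
  have hmem : ∀ y, e y ∈ obs y := by
    intro y
    by_cases hy : y = none
    · simp [obs, hy]
    · simp [obs, hy]
  have hdelta : ∀ t, G.delta (e (x t)) (ψ x t).2 (e (x (t + 1))) := by
    intro t
    have := (hG.delta _ _ _).2 (hedge t)
    rwa [f.apply_symm_apply] at this
  intro hst
  have hsum : ∀ t, G.sumW (fun t => (e (x t), (ψ x t).2)) t =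
      weight M n (fun x t => f.symm (ψ x t).2) x t := by
    intro t
    refine Finset.sum_congr rfl fun i _ => ?_
    rw [← hG.w _ _ _ (hedge i), f.apply_symm_apply]
  refine absurd (hst (ψ x) ⟨⟨fun t => ?_, fun t => ⟨_, hmem _, _, hmem _, hdelta t⟩⟩, ?_⟩ ?_
    (fun t => (e (x t), (ψ x t).2)) ⟨hdelta, fun t => ⟨hmem _, rfl⟩⟩)
    (not_le.2 (mp_neg_of_le G _ D fun k => ?_))
  · rw [hG.obs]
    by_cases hy : x t = none
    · simp [ψ, obs, hy]
    · simp [ψ, obs, hy]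
  · rw [hG.qI, ← hx0]
    exact hmem _
  · intro t
    rw [hψ]
  · obtain ⟨t, ht, h⟩ := hx k
    exact ⟨t, ht, by rwa [hsum]⟩

end Simulation

section Encoding

lemma computable_ofNat {f : ℕ → ℕ} (hf : Computable f) : Computable fun n => (f n : ℤ) := by
  refine Computable.encode_iff.1 ((Primrec.nat_double.to_comp.comp hf).of_eq fun n => ?_)
  rfl

lemma computable_negSucc {f : ℕ → ℕ} (hf : Computable f) :
    Computable fun n => Int.negSucc (f n) := by
  refine Computable.encode_iff.1 ((Primrec.nat_double_succ.to_comp.comp hf).of_eq fun n => ?_)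
  rfl

lemma computable_input (i : ℕ) : Computable fun n => (input n i : ℤ) := by
  by_cases hi : i = 0
  · subst hi
    exact computable_ofNat Computable.succ
  · simp only [input, hi, if_false]
    exact Computable.const _

lemma computable_neg_input (i : ℕ) : Computable fun n => -(input n i : ℤ) := by
  by_cases hi : i = 0
  · subst hi
    exact (computable_negSucc Computable.id).of_eq fun n => rfl
  · simp only [input, hi, if_false]
    exact Computable.const _

variable {C : Type} {B : ℕ}

lemma computable_wt (M : C → Instr C) (x : GState C B) (a : Fin 3) (y : GState C B) :
    Computable fun n => wt M n x a y := by
  rcases x with _ | ⟨m, q⟩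
  · rcases y with _ | ⟨i | i | _ | _, q'⟩
    · exact Computable.const 0
    · exact computable_input i
    · exact computable_neg_input i
    · exact Computable.const 0
    · exact Computable.const 0
  · exact Computable.const (wt M 0 (some (m, q)) a y)

/-- The code of the game simulating `M` on the input `n`, for a numbering `e` of the states. -/
noncomputable def code [Finite C] (M : C → Instr C) (q₀ : C) {N : ℕ} (e : GState C B ≃ Fin N)
    (n : ℕ) : GameCode :=
  (N, 3, (e none : ℕ),
    (Set.toFinite {x : GState C B × Fin 3 × GState C B |
      Edge M q₀ x.1 x.2.1 x.2.2}).toFinset.toList.map fun x =>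
        ((e x.1 : ℕ), (x.2.1 : ℕ), (e x.2.2 : ℕ), wt M n x.1 x.2.1 x.2.2),
    [[(e none : ℕ)],
      (Set.toFinite {x : GState C B | x ≠ none}).toFinset.toList.map fun x => (e x : ℕ)])

variable [Finite C] (M : C → Instr C) (q₀ : C) {N : ℕ} (e : GState C B ≃ Fin N)

lemma computable_code : Computable (code M q₀ e) := by
  have hl : ∀ l : List (GState C B × Fin 3 × GState C B), Computable fun n => l.map fun x =>
      ((e x.1 : ℕ), (x.2.1 : ℕ), (e x.2.2 : ℕ), wt M n x.1 x.2.1 x.2.2) := by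
    intro l
    induction l with
    | nil => exact Computable.const []
    | cons x l ih =>
      exact Computable.list_cons.comp ((Computable.const _).pair ((Computable.const _).pair
        ((Computable.const _).pair (computable_wt M x.1 x.2.1 x.2.2)))) ih
  exact (Computable.const _).pair ((Computable.const _).pair ((Computable.const _).pair
    ((hl _).pair (Computable.const _))))

variable {M q₀ e}

lemma mem_trans_code {n q a q' : ℕ} {z : ℤ} :
    (q, a, q', z) ∈ (code M q₀ e n).trans ↔ ∃ x b y, Edge M q₀ x b y ∧ (e x : ℕ) = q ∧
      (b : ℕ) = a ∧ (e y : ℕ) = q' ∧ wt M n x b y = z := by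
  simp [code, GameCode.trans]

lemma mem_trans_code_iff {n : ℕ} {x y : GState C B} {a : Fin 3} {z : ℤ} :
    ((e x : ℕ), (a : ℕ), (e y : ℕ), z) ∈ (code M q₀ e n).trans ↔
      Edge M q₀ x a y ∧ wt M n x a y = z := by
  rw [mem_trans_code]
  constructor
  · rintro ⟨x', b, y', h, hx, hb, hy, hz⟩
    obtain rfl := e.injective (Fin.ext hx)
    obtain rfl := e.injective (Fin.ext hy)
    obtain rfl := Fin.ext hb
    exact ⟨h, hz⟩
  · rintro ⟨h, hz⟩
    exact ⟨x, a, y, h, rfl, rfl, rfl, hz⟩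

lemma obs_code (n : ℕ) : {s : Set (Fin N) | ∃ l ∈ (code M q₀ e n).obsL,
    s = {q : Fin N | (q : ℕ) ∈ l}} = {{e none}, {e none}ᶜ} := by
  have h₁ : {q : Fin N | (q : ℕ) = (e none : ℕ)} = {e none} := by
    ext q
    simp [Fin.ext_iff]
  have h₂ : {q : Fin N | (q : ℕ) ∈ (Set.toFinite
      {x : GState C B | x ≠ none}).toFinset.toList.map fun x => (e x : ℕ)} = {e none}ᶜ := by
    ext q
    obtain ⟨x, rfl⟩ := e.surjective q
    simp only [Set.mem_ofPred_eq, List.mem_map, Finset.mem_toList, Set.Finite.mem_toFinset,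
      Set.mem_compl_iff, Set.mem_singleton_iff, e.injective.eq_iff]
    constructor
    · rintro ⟨y, hy, h⟩
      rwa [← e.injective (Fin.ext h)]
    · exact fun hx => ⟨x, hx, rfl⟩
  ext s
  simp only [code, GameCode.obsL, List.mem_cons, List.not_mem_nil, or_false, Set.mem_ofPred_eq,
    exists_eq_or_imp, exists_eq_left, Set.mem_insert_iff, Set.mem_singleton_iff]
  rw [h₁, h₂]

lemma wf_code (n : ℕ) : GameCode.WF (code M q₀ e n) where
  hqI := (e none).isLt
  hnA := Nat.succ_pos 2
  htotal := by
    intro q hq a ha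
    obtain ⟨y, hy⟩ := exists_edge M q₀ (e.symm ⟨q, hq⟩) ⟨a, ha⟩
    refine ⟨e y, (e y).isLt, _, mem_trans_code.2 ⟨_, _, _, hy, ?_, rfl, rfl, rfl⟩⟩
    rw [e.apply_symm_apply]
  hrange := by
    rintro ⟨q, a, q', z⟩ h
    obtain ⟨x, b, y, -, rfl, rfl, rfl, -⟩ := mem_trans_code.1 h
    exact ⟨(e x).isLt, b.isLt, (e y).isLt⟩
  hwfun := by
    intro q a q' z z' h h'
    obtain ⟨x, b, y, -, rfl, rfl, rfl, rfl⟩ := mem_trans_code.1 h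
    exact (mem_trans_code_iff.1 h').2
  hpart := by
    change Setoid.IsPartition {s : Set (Fin N) | ∃ l ∈ (code M q₀ e n).obsL,
      s = {q : Fin N | (q : ℕ) ∈ l}}
    rw [obs_code]
    constructor
    · rintro (h | h)
      · exact Set.singleton_ne_empty _ h.symm
      · have : e (some (.cnt, q₀)) ∈ ({e none}ᶜ : Set (Fin N)) := by simp
        rw [← h] at this
        exact this
    · intro q
      by_cases hq : q = e none
      · refine ⟨{e none}, by simp [hq], ?_⟩
        rintro s ⟨rfl | rfl, hs⟩
        · rfl
        · exact absurd hq hs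
      · refine ⟨{e none}ᶜ, by simp [hq], ?_⟩
        rintro s ⟨rfl | rfl, hs⟩
        · exact absurd hs hq
        · rfl

lemma simulates_code (n : ℕ) (h : GameCode.WF (code M q₀ e n)) :
    Simulates M q₀ n (GameCode.toMPG _ h) e (Equiv.refl (Fin 3)) where
  qI := rfl
  delta x a y := by
    change (∃ z, ((e x : ℕ), (a : ℕ), (e y : ℕ), z) ∈ (code M q₀ e n).trans) ↔ _
    simp [mem_trans_code_iff]
  w x a y he := by
    have hz : ∃ z, ((e x : ℕ), (a : ℕ), (e y : ℕ), z) ∈ (code M q₀ e n).trans :=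
      ⟨_, mem_trans_code_iff.2 ⟨he, rfl⟩⟩
    exact (dif_pos hz).trans (mem_trans_code_iff.1 hz.choose_spec).2.symm
  obs := obs_code n

end Encoding

end CounterMachine

/-- on codes of finite MPGs with partial-observation, the predicate
"Eve has a winning observation-based strategy" is undecidable. -/
theorem eveWins_undecidable :
    ¬ ∃ p : GameCode → Bool, Computable p ∧
      ∀ (c : GameCode) (h : GameCode.WF c),
        (p c = true ↔
          ∃ st : (GameCode.toMPG c h).EveStrategy,
            (GameCode.toMPG c h).EveWinningStrategy st) := by
  rintro ⟨p, hp, hpw⟩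
  obtain ⟨C, _, M, q₀, hM⟩ := CounterMachine.exists_machine_undecidable
  have hbound : ∃ B, 0 < B ∧ ∀ q r t z, M q = .jzd r t z → r < B := by
    obtain ⟨B, hB⟩ := (Set.finite_range fun q =>
      match M q with | .jzd r _ _ => r | _ => 0).bddAbove
    refine ⟨B + 1, B.succ_pos, fun q r t z h => Nat.lt_succ_of_le ?_⟩
    have := hB ⟨q, rfl⟩
    simpa [h] using this
  obtain ⟨B, hB, hB'⟩ := hbound
  obtain ⟨N, ⟨e⟩⟩ := Finite.exists_equiv_fin (CounterMachine.GState C B)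
  refine hM (ComputablePred.computable_iff.2 ⟨fun n => !p (CounterMachine.code M q₀ e n),
    Primrec.not.to_comp.comp (hp.comp (CounterMachine.computable_code M q₀ e)), ?_⟩)
  ext n
  have hs := CounterMachine.simulates_code n (CounterMachine.wf_code (M := M) (q₀ := q₀) (e := e) n)
  rw [Bool.not_eq_true', ← Bool.not_eq_true, hpw _ (CounterMachine.wf_code n)]
  constructor
  · rintro hn ⟨st, hst⟩
    exact hs.not_eveWinningStrategy hB hB' hn st hst
  · intro h
    by_contra hn
    exact h (hs.exists_eveWinningStrategy hn)
end

section
/- Assume co-analytic determinacy: for every nonempty countable set A (with the discrete topology) and every payoff set P ⊆ A^ℕ whose complement is an analytic subset of A^ℕ (with the product topology), the Gale–Stewart game on A with payoff P, in which two players alternately choose elements of A and the first player wins iff the resulting sequence lies in P, is determined. Then in every MPG with limited-observation, either Eve has a winning observation-based strategy or Adam has a winning observation-based strategy. -/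
open Classical

section GaleStewart

variable {A : Type}

/-- The history of the Gale–Stewart game after `n` moves, when the first player uses
`s1` (moving at even stages) and the second uses `s2` (moving at odd stages). -/
def gsHist (s1 s2 : List A → A) : ℕ → List A
  | 0 => []
  | n + 1 => gsHist s1 s2 n ++ [(if n % 2 = 0 then s1 else s2) (gsHist s1 s2 n)]

/-- The infinite sequence produced in the Gale–Stewart game by strategies `s1`, `s2`. -/
def gsPlay (s1 s2 : List A → A) (n : ℕ) : A :=
  (if n % 2 = 0 then s1 else s2) (gsHist s1 s2 n)

end GaleStewart

/-- Co-analytic determinacy: for every nonempty countable `A` (discrete) and every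
payoff set `P ⊆ A^ℕ` whose complement is analytic, the Gale–Stewart game on `A` with
payoff `P` is determined. -/
def CoAnalyticDeterminacy : Prop :=
  ∀ (A : Type), Countable A → Nonempty A → ∀ P : Set (ℕ → A),
    @MeasureTheory.AnalyticSet (ℕ → A)
      (@Pi.topologicalSpace ℕ (fun _ => A) (fun _ => ⊥)) Pᶜ →
    (∃ s1 : List A → A, ∀ s2 : List A → A, gsPlay s1 s2 ∈ P) ∨
    (∃ s2 : List A → A, ∀ s1 : List A → A, gsPlay s1 s2 ∉ P)

section GaleStewart

variable {A : Type}

theorem length_gsHist (s1 s2 : List A → A) (n : ℕ) : (gsHist s1 s2 n).length = n := by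
  induction n with
  | zero => rfl
  | succ n ih => simp [gsHist, ih]

theorem gsHist_congr {s1 s2 t1 t2 : List A → A} {n : ℕ}
    (h1 : ∀ l : List A, l.length < n → s1 l = t1 l)
    (h2 : ∀ l : List A, l.length < n → s2 l = t2 l) :
    gsHist s1 s2 n = gsHist t1 t2 n := by
  induction n with
  | zero => rfl
  | succ n ih =>
    have e := ih (fun l hl => h1 l (by omega)) (fun l hl => h2 l (by omega))
    have hl := length_gsHist t1 t2 n
    simp only [gsHist, e]
    split_ifs
    · rw [h1 _ (by omega)]
    · rw [h2 _ (by omega)]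

theorem gsPlay_even (s1 s2 : List A → A) (i : ℕ) :
    gsPlay s1 s2 (2 * i) = s1 (gsHist s1 s2 (2 * i)) := by
  simp [gsPlay]

theorem gsPlay_odd (s1 s2 : List A → A) (i : ℕ) :
    gsPlay s1 s2 (2 * i + 1) = s2 (gsHist s1 s2 (2 * i + 1)) := by
  simp [gsPlay, Nat.add_mod]

end GaleStewart

namespace MPG

variable (G : MPG)

/-- The observation `o'` may follow the observation `o` under the action `a`. -/
def IsLegal (o : Set G.Q) (a : G.A) (o' : Set G.Q) : Prop :=
  o' ∈ G.Obs ∧ (o' ∩ G.post o a).Nonempty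

/-- The observation `o'` if it may follow `o` under `a`, and otherwise some observation
that may. -/
noncomputable def legalize (o : Set G.Q) (a : G.A) (o' : Set G.Q) : Set G.Q :=
  if G.IsLegal o a o' then o' else epsilon (G.IsLegal o a)

variable {G}

theorem exists_isLegal {o : Set G.Q} (ho : o ∈ G.Obs) (a : G.A) : ∃ o', G.IsLegal o a o' := by
  obtain ⟨q, hq⟩ := Setoid.nonempty_of_mem_partition G.partition ho
  obtain ⟨q', hq'⟩ := G.total q a
  obtain ⟨o', ⟨ho', hqo'⟩, -⟩ := G.partition.2 q'
  exact ⟨o', ho', q', hqo', q, hq, hq'⟩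

theorem isLegal_legalize {o : Set G.Q} (ho : o ∈ G.Obs) (a : G.A) (o' : Set G.Q) :
    G.IsLegal o a (G.legalize o a o') := by
  unfold legalize
  split_ifs with h
  · exact h
  · exact epsilon_spec (exists_isLegal ho a)

theorem legalize_of_isLegal {o : Set G.Q} {a : G.A} {o' : Set G.Q} (h : G.IsLegal o a o') :
    G.legalize o a o' = o' :=
  if_pos h

theorem IsPlay.isLegal {ψ : ℕ → Set G.Q × G.A} (h : G.IsPlay ψ) (i : ℕ) :
    G.IsLegal (ψ i).1 (ψ i).2 (ψ (i + 1)).1 := by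
  obtain ⟨q, hq, q', hq', hd⟩ := h.1.2 i
  exact ⟨h.1.1 (i + 1), q', hq', q, hq, hd⟩

theorem IsPlay.fst_zero {ψ : ℕ → Set G.Q × G.A} (h : G.IsPlay ψ)
    (hI : ({G.qI} : Set G.Q) ∈ G.Obs) : (ψ 0).1 = {G.qI} :=
  (G.partition.2 G.qI).unique ⟨h.1.1 0, h.2⟩ ⟨hI, rfl⟩

theorem not_winningForEve {ψ : ℕ → Set G.Q × G.A} :
    ¬ G.WinningForEve ψ ↔ G.WinningForAdam ψ := by
  simp [WinningForEve, WinningForAdam]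

theorem getElem?_hist_append (ψ : ℕ → Set G.Q × G.A) {i j : ℕ} (hj : j ≤ i)
    (p : Set G.Q × G.A) :
    (G.hist ψ i ++ [p])[j]? = some (if j = i then p else ψ j) := by
  rcases hj.eq_or_lt with rfl | hj
  · simp [hist]
  · simp [hist, List.getElem?_append, hj, hj.ne]

variable (G)

/-- The observations of the play described by a run of the Gale–Stewart game in which Eve
chooses actions at even stages and Adam chooses observations at odd stages. -/
noncomputable def decodeObs (x : ℕ → Set G.Q × G.A) : ℕ → Set G.Q
  | 0 => {G.qI}
  | n + 1 => G.legalize (decodeObs x n) (x (2 * n)).2 (x (2 * n + 1)).1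

/-- The play described by a run of the Gale–Stewart game. -/
noncomputable def decode (x : ℕ → Set G.Q × G.A) (n : ℕ) : Set G.Q × G.A :=
  (G.decodeObs x n, (x (2 * n)).2)

variable {G}

theorem decode_eq {ψ x : ℕ → Set G.Q × G.A} (h0 : (ψ 0).1 = {G.qI})
    (hE : ∀ i, (ψ i).2 = (x (2 * i)).2)
    (hA : ∀ i, (ψ (i + 1)).1 = G.legalize (ψ i).1 (ψ i).2 (x (2 * i + 1)).1) :
    G.decode x = ψ := by
  have key : ∀ i, G.decodeObs x i = (ψ i).1 := by
    intro i
    induction i with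
    | zero => exact h0.symm
    | succ i ih => rw [decodeObs, ih, hA, hE]
  funext i
  exact Prod.ext (key i) (hE i).symm

theorem analyticSet_winningForAdam_decode :
    @MeasureTheory.AnalyticSet (ℕ → Set G.Q × G.A)
      (@Pi.topologicalSpace ℕ (fun _ => Set G.Q × G.A) (fun _ => ⊥))
      {x | G.WinningForAdam (G.decode x)} := by
  have := G.fintypeQ
  have := G.fintypeA
  let : TopologicalSpace (Set G.Q × G.A) := ⊥
  let : TopologicalSpace (G.Q × G.A) := ⊥
  let : TopologicalSpace (Set G.Q) := ⊥
  have : DiscreteTopology (Set G.Q × G.A) := ⟨rfl⟩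
  have : DiscreteTopology (G.Q × G.A) := ⟨rfl⟩
  have : DiscreteTopology (Set G.Q) := ⟨rfl⟩
  have : PolishSpace (Set G.Q × G.A) := inferInstance
  have : PolishSpace (G.Q × G.A) := inferInstance
  have : PolishSpace (ℕ → Set G.Q × G.A) := inferInstance
  let : MeasurableSpace ((ℕ → Set G.Q × G.A) × (ℕ → G.Q × G.A)) := borel _
  have : BorelSpace ((ℕ → Set G.Q × G.A) × (ℕ → G.Q × G.A)) := ⟨rfl⟩
  have hx : ∀ i, Continuous
      fun z : (ℕ → Set G.Q × G.A) × (ℕ → G.Q × G.A) => z.1 i :=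
    fun i => (continuous_apply i).comp continuous_fst
  have hπ : ∀ i, Continuous
      fun z : (ℕ → Set G.Q × G.A) × (ℕ → G.Q × G.A) => z.2 i :=
    fun i => (continuous_apply i).comp continuous_snd
  have hobs : ∀ i, Continuous
      fun z : (ℕ → Set G.Q × G.A) × (ℕ → G.Q × G.A) => G.decodeObs z.1 i := by
    intro i
    induction i with
    | zero => exact continuous_const
    | succ i ih =>
      exact (continuous_of_discreteTopology
        (f := fun p : Set G.Q × (Set G.Q × G.A) × (Set G.Q × G.A) =>
          G.legalize p.1 p.2.1.2 p.2.2.1)).comp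
        (ih.prodMk ((hx (2 * i)).prodMk (hx (2 * i + 1))))
  have hpath : MeasurableSet
      {z : (ℕ → Set G.Q × G.A) × (ℕ → G.Q × G.A) | G.IsConcretePath z.2} := by
    simp only [IsConcretePath, Set.ofPred_forall]
    refine MeasurableSet.iInter fun i => IsOpen.measurableSet ?_
    exact (isOpen_discrete {p : (G.Q × G.A) × (G.Q × G.A) |
      G.delta p.1.1 p.1.2 p.2.1}).preimage ((hπ i).prodMk (hπ (i + 1)))
  have hcomp : MeasurableSet {z : (ℕ → Set G.Q × G.A) × (ℕ → G.Q × G.A) |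
      ∀ i, (z.2 i).1 ∈ G.decodeObs z.1 i ∧ (z.2 i).2 = (z.1 (2 * i)).2} := by
    simp only [Set.ofPred_forall]
    refine MeasurableSet.iInter fun i => IsOpen.measurableSet ?_
    exact (isOpen_discrete {p : (G.Q × G.A) × Set G.Q × (Set G.Q × G.A) |
      p.1.1 ∈ p.2.1 ∧ p.1.2 = p.2.2.2}).preimage
      ((hπ i).prodMk ((hobs i).prodMk (hx (2 * i))))
  have hsum : ∀ n, Continuous
      fun z : (ℕ → Set G.Q × G.A) × (ℕ → G.Q × G.A) => (G.sumW z.2 n : ℝ) := by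
    intro n
    simp only [sumW, Int.cast_sum]
    refine continuous_finsetSum _ fun i _ => ?_
    exact (continuous_of_discreteTopology
      (f := fun p : (G.Q × G.A) × (G.Q × G.A) => (G.w p.1.1 p.1.2 p.2.1 : ℝ))).comp
      ((hπ i).prodMk (hπ (i + 1)))
  have hMP : Measurable
      fun z : (ℕ → Set G.Q × G.A) × (ℕ → G.Q × G.A) => G.MP z.2 :=
    Measurable.liminf fun n => ((hsum n).div_const (n : ℝ)).measurable
  have hmeas := (hpath.inter hcomp).inter (measurableSet_lt hMP (measurable_const (a := (0 : ℝ))))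
  convert hmeas.analyticSet.image_of_continuous continuous_fst using 1
  ext x
  simp [WinningForAdam, gamma, decode, and_assoc]

theorem exists_eveWinningStrategy (hI : ({G.qI} : Set G.Q) ∈ G.Obs)
    {s1 : List (Set G.Q × G.A) → Set G.Q × G.A}
    (h : ∀ s2, G.WinningForEve (G.decode (gsPlay s1 s2))) :
    ∃ st : G.EveStrategy, G.EveWinningStrategy st := by
  have a0 := G.nonemptyA.some
  let adam (f : ℕ → Set G.Q) (l : List (Set G.Q × G.A)) : Set G.Q × G.A :=
    (f ((l.length + 1) / 2), a0)
  refine ⟨fun hs o => (s1 (gsHist s1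
    (adam fun j => ((hs ++ [(o, a0)])[j]?.getD (o, a0)).1) (2 * hs.length))).2, ?_⟩
  intro ψ hψ hc
  have hdec : G.decode (gsPlay s1 (adam fun j => (ψ j).1)) = ψ := by
    refine decode_eq (hψ.fst_zero hI) (fun i => ?_) (fun i => ?_)
    · rw [hc i, gsPlay_even]
      simp only [show (G.hist ψ i).length = i by simp [hist]]
      rw [gsHist_congr (fun _ _ => rfl) fun l hl => ?_]
      have hj : (l.length + 1) / 2 ≤ i := by omega
      simp only [adam, getElem?_hist_append ψ hj]
      split_ifs with e <;> simp [e]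
    · have e : (2 * i + 1 + 1) / 2 = i + 1 := by omega
      rw [gsPlay_odd]
      simp only [adam, length_gsHist, e]
      exact (legalize_of_isLegal (hψ.isLegal i)).symm
  exact hdec ▸ h _

theorem exists_adamWinningStrategy (hI : ({G.qI} : Set G.Q) ∈ G.Obs)
    {s2 : List (Set G.Q × G.A) → Set G.Q × G.A}
    (h : ∀ s1, G.WinningForAdam (G.decode (gsPlay s1 s2))) :
    ∃ st : G.AdamStrategy, G.AdamWinningStrategy st := by
  let eve (f : ℕ → G.A) (l : List (Set G.Q × G.A)) : Set G.Q × G.A := (∅, f (l.length / 2))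
  refine ⟨fun hs o a => G.legalize o a (s2 (gsHist
    (eve fun j => ((hs ++ [(o, a)])[j]?.getD (o, a)).2) s2 (2 * hs.length + 1))).1,
    fun ψ hψ i a => isLegal_legalize (hψ.1.1 i) a _, ?_⟩
  intro ψ hψ hc
  have hdec : G.decode (gsPlay (eve fun j => (ψ j).2) s2) = ψ := by
    refine decode_eq (hψ.fst_zero hI) (fun i => ?_) (fun i => ?_)
    · rw [gsPlay_even]
      simp [eve, length_gsHist]
    · rw [hc i, gsPlay_odd]
      simp only [show (G.hist ψ i).length = i by simp [hist]]
      rw [gsHist_congr (fun l hl => ?_) fun _ _ => rfl]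
      have hj : l.length / 2 ≤ i := by omega
      simp only [eve, getElem?_hist_append ψ hj]
      split_ifs with e <;> simp [e]
  exact hdec ▸ h _

end MPG

/-- assuming co-analytic determinacy, every MPG with limited-observation
is determined with observation-based strategies. -/
theorem mpg_observable_determinacy (hdet : CoAnalyticDeterminacy)
    (G : MPG) (hG : G.LimitedObs) :
    (∃ st : G.EveStrategy, G.EveWinningStrategy st) ∨
    (∃ st : G.AdamStrategy, G.AdamWinningStrategy st) := by
  have := G.fintypeQ
  have := G.fintypeA
  have := G.nonemptyA
  have hcompl : {x | G.WinningForEve (G.decode x)}ᶜ = {x | G.WinningForAdam (G.decode x)} :=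
    Set.ext fun x => MPG.not_winningForEve
  rcases hdet (Set G.Q × G.A) inferInstance inferInstance
      {x | G.WinningForEve (G.decode x)}
      (hcompl ▸ MPG.analyticSet_winningForAdam_decode) with ⟨s1, h1⟩ | ⟨s2, h2⟩
  · exact Or.inl (MPG.exists_eveWinningStrategy hG.1 h1)
  · exact Or.inr (MPG.exists_adamWinningStrategy hG.1
      fun s1 => MPG.not_winningForEve.1 (h2 s1))
end

section
/- Let G be an MPG with limited-observation and let f_0 σ_0 f_1 … σ_{n-1} f_n be a sequence of functions in F such that each f_{i+1} is a proper σ_i-successor of f_i, and write o_i = supp(f_i). Then for every q ∈ supp(f_n), f_n(q) = min{ f_0(q_0) + w(π) : π = q_0 σ_0 q_1 … q_n is a concrete path with q_i ∈ o_i for all i and q_n = q }, where w(π) is the sum of the weights of the transitions of π and (+∞) + k = +∞. -/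
open Classical

/-- for a sequence of proper successors, `fₙ(q)` is the minimum of
`f₀(q₀) + w(π)` over concrete paths `π` through the supports ending at `q`. -/
theorem properSucc_sequence_min_path (G : MPG) (hG : G.LimitedObs)
    (n : ℕ) (fs : ℕ → G.FF) (as : ℕ → G.A)
    (hsucc : ∀ i < n, G.IsProperSucc (fs i) (as i) (fs (i + 1)))
    (q : G.Q) (hq : q ∈ G.Fsupp (fs n)) :
    ∃ m : WithTop ℤ, fs n q = some m ∧
      MPG.IsMinOf m
        {x : WithTop ℤ | ∃ π : ℕ → G.Q,
          (∀ i < n, G.delta (π i) (as i) (π (i + 1))) ∧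
          (∀ i ≤ n, π i ∈ G.Fsupp (fs i)) ∧ π n = q ∧
          ∃ v : WithTop ℤ, fs 0 (π 0) = some v ∧
            x = v + ((∑ i ∈ Finset.range n, G.w (π i) (as i) (π (i + 1)) : ℤ) :
              WithTop ℤ)} := by
  induction n generalizing q with
  | zero =>
    obtain ⟨m, hm⟩ := Option.ne_none_iff_exists'.mp hq
    refine ⟨m, hm, ⟨fun _ => q, by simp, ?_, rfl, m, hm, by simp⟩, ?_⟩
    · intro i hi
      obtain rfl : i = 0 := by omega
      exact hq
    · rintro x ⟨π, -, -, hπ, v, hv, rfl⟩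
      rw [hπ, hm, Option.some_inj] at hv
      simp [hv]
  | succ n ih =>
    have ih' := ih fun i hi => hsucc i (by omega)
    obtain ⟨m, hm, ⟨p, u, hu, hd, rfl⟩, hmin⟩ := (hsucc n (by omega)).2 q hq
    refine ⟨_, hm, ?_, ?_⟩
    · have hp : p ∈ G.Fsupp (fs n) := by simp [MPG.Fsupp, hu]
      obtain ⟨u', hu', ⟨π, hπd, hπs, rfl, v, hv, hx⟩, -⟩ := ih' p hp
      obtain rfl : u = u' := by simpa [hu] using hu'
      refine ⟨fun i => if i ≤ n then π i else q, ?_, ?_, by simp, v, by simpa using hv, ?_⟩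
      · intro i hi
        rcases Nat.lt_succ_iff_lt_or_eq.mp hi with h | rfl
        · simpa [h.le, Nat.succ_le_of_lt h] using hπd i h
        · simpa using hd
      · intro i hi
        by_cases h : i ≤ n
        · simpa [h] using hπs i h
        · obtain rfl : i = n + 1 := by omega
          simpa using hq
      · have hsum : ∑ i ∈ Finset.range n,
            G.w (if i ≤ n then π i else q) (as i) (if i + 1 ≤ n then π (i + 1) else q) =
            ∑ i ∈ Finset.range n, G.w (π i) (as i) (π (i + 1)) := by
          refine Finset.sum_congr rfl fun i hi => ?_
          have h := Finset.mem_range.mp hi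
          rw [if_pos h.le, if_pos (Nat.succ_le_of_lt h)]
        rw [Finset.sum_range_succ, hsum, hx, WithTop.coe_add, add_assoc]
        simp
    · rintro x ⟨π, hπd, hπs, rfl, v, hv, rfl⟩
      obtain ⟨u', hu', -, hmin'⟩ := ih' (π n) (hπs n (by omega))
      have hle := hmin' _ ⟨π, fun i hi => hπd i (by omega), fun i hi => hπs i (by omega),
        rfl, v, hv, rfl⟩
      refine (hmin _ ⟨π n, u', hu', hπd n (by omega), rfl⟩).trans ?_
      rw [Finset.sum_range_succ, WithTop.coe_add, ← add_assoc]
      gcongr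
end

section
/- Let G be an MPG with limited-observation and Γ_G its associated reachability game. If λ is a winning strategy for Eve or a winning strategy for Adam in Γ_G, then there exists N ∈ ℕ such that every play of Γ_G consistent with λ has length at most N (each position reached consists of at most N functions). -/
open Classical

/-- **Kőnig's lemma** for a finitely branching relation: if every infinite `R`-chain from `a`
reaches a set `T` of points at which chains are stationary, then any `ℕ`-valued measure is
bounded along all infinite `R`-chains from `a`. -/
theorem exists_bound_of_finite_branching {α : Type*} {R : α → α → Prop} {T : α → Prop}
    (len : α → ℕ) (a : α) (hfin : ∀ x, {y | R x y}.Finite) (hT : ∀ x y, T x → R x y → y = x)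
    (hreach : ∀ u : ℕ → α, u 0 = a → (∀ k, R (u k) (u (k + 1))) → ∃ k, T (u k)) :
    ∃ N, ∀ u : ℕ → α, u 0 = a → (∀ k, R (u k) (u (k + 1))) → ∀ k, len (u k) ≤ N := by
  let Bdd : α → Prop := fun x =>
    ∃ N, ∀ u : ℕ → α, u 0 = x → (∀ k, R (u k) (u (k + 1))) → ∀ k, len (u k) ≤ N
  have bdd_of_succ : ∀ x, (∀ y, R x y → Bdd y) → Bdd x := by
    intro x hx
    choose! N hN using hx
    obtain ⟨M, hM⟩ := ((hfin x).image N).bddAbove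
    refine ⟨max (len x) M, fun u hu hR k => ?_⟩
    cases k with
    | zero => exact hu ▸ le_max_left _ _
    | succ k =>
      have h1 : R x (u 1) := hu ▸ hR 0
      exact (hN _ h1 (fun k => u (k + 1)) rfl (fun k => hR (k + 1)) k).trans
        ((hM ⟨_, h1, rfl⟩).trans (le_max_right _ _))
  have bdd_of_mem : ∀ x, T x → Bdd x := by
    refine fun x hx => ⟨len x, fun u hu hR k => ?_⟩
    have hconst : ∀ k, u k = x := by
      intro k
      induction k with
      | zero => exact hu
      | succ k ih => exact hT x _ hx (ih ▸ hR k)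
    rw [hconst k]
  by_contra ha
  have hstep : ∀ x : {x // ¬ Bdd x}, ∃ y : {x // ¬ Bdd x}, R x y := by
    rintro ⟨x, hx⟩
    by_contra! h
    exact hx (bdd_of_succ x fun y hy => by_contra fun hn => h ⟨y, hn⟩ hy)
  choose next hnext using hstep
  let v : ℕ → {x // ¬ Bdd x} := fun k => next^[k] ⟨a, ha⟩
  obtain ⟨k, hk⟩ := hreach (fun k => (v k : α)) rfl fun k => by
    simpa only [v, Function.iterate_succ_apply'] using hnext (v k)
  exact (v k).2 (bdd_of_mem _ hk)

namespace MPG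

variable (G : MPG)

theorem finite_isSucc (f : G.FF) (a : G.A) : {f' | G.IsSucc f a f'}.Finite := by
  have := G.fintypeQ
  have hmin : ∀ q, {m | IsMinOf m (G.transVals f a q)}.Finite := fun q =>
    Set.Subsingleton.finite fun m hm n hn => le_antisymm (hm.2 n hn.1) (hn.2 m hm.1)
  refine (Set.Finite.pi' fun q => ((hmin q).image some).union
    (Set.toFinite ({none, some ⊤} : Set (Option (WithTop ℤ))))).subset fun f' hf' q => ?_
  by_cases hq : f' q = none
  · exact Or.inr (Or.inl hq)
  · rcases hf'.2.2 q hq with h | ⟨m, h, hm⟩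
    · exact Or.inr (Or.inr h)
    · exact Or.inl ⟨m, hm, h.symm⟩

variable {G}

theorem ValidPos.isSucc_of_extend {p : G.Pos} {a : G.A} {f : G.FF}
    (h : G.ValidPos (G.extend p a f)) : G.IsSucc p.2 a f := by
  have := h.2.1 p.1.length (by simp [extend])
  simpa [posFun, extend] using this

theorem finite_eveNext (sE : G.Pos → G.A) (p : G.Pos) :
    {p' | G.EveNext G.ValidPos sE p p'}.Finite := by
  refine (((G.finite_isSucc p.2 (sE p)).image (G.extend p (sE p))).insert p).subset
    fun p' hp' => ?_
  by_cases ht : G.TerminalPos p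
  · exact Or.inl (hp'.1 ht)
  · rcases hp'.2 ht with ⟨f, rfl, hf⟩ | ⟨_, h⟩
    · exact Or.inr ⟨f, hf.isSucc_of_extend, rfl⟩
    · exact Or.inl h

theorem finite_adamNext (V : G.Pos → Prop) (sA : G.Pos → G.A → G.FF) (p : G.Pos) :
    {p' | G.AdamNext V sA p p'}.Finite := by
  have := G.fintypeA
  refine ((Set.finite_range fun a => G.extend p a (sA p a)).insert p).subset fun p' hp' => ?_
  by_cases ht : G.TerminalPos p
  · exact Or.inl (hp'.1 ht)
  · obtain ⟨a, ⟨_, h⟩ | ⟨_, h⟩⟩ := hp'.2 ht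
    · exact Or.inr ⟨a, h.symm⟩
    · exact Or.inl h

end MPG

/-- winning strategies in `Γ_G` only admit plays of bounded length. -/
theorem winning_strategy_bounded_plays (G : MPG) (hG : G.LimitedObs) :
    (∀ sE : G.Pos → G.A, G.EveWinningR G.ValidPos sE →
      ∃ N : ℕ, ∀ ps : ℕ → G.Pos, ps 0 = G.initPos →
        (∀ k, G.EveNext G.ValidPos sE (ps k) (ps (k + 1))) →
        ∀ k, (ps k).1.length + 1 ≤ N) ∧
    (∀ sA : G.Pos → G.A → G.FF, G.AdamWinningR G.ValidPos sA →
      ∃ N : ℕ, ∀ ps : ℕ → G.Pos, ps 0 = G.initPos →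
        (∀ k, G.AdamNext G.ValidPos sA (ps k) (ps (k + 1))) →
        ∀ k, (ps k).1.length + 1 ≤ N) := by
  constructor
  · intro sE hE
    exact exists_bound_of_finite_branching (fun p : G.Pos => p.1.length + 1) G.initPos
      (MPG.finite_eveNext sE) (fun _ _ ht h => h.1 (Or.inl ht)) hE
  · intro sA hA
    exact exists_bound_of_finite_branching (fun p : G.Pos => p.1.length + 1) G.initPos
      (MPG.finite_adamNext G.ValidPos sA) (fun _ _ ht h => h.1 (Or.inr ht)) hA
end

section
/- Let G be an MPG with limited-observation and let ρ be a good abstract cycle. Then for every k ≥ 1 and every concrete path π ∈ γ(ρ^k) that starts and ends at the same state (a concrete cycle), the weight w(π) of π is ≥ 0. -/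
open Classical

namespace MPG

/-- A (finite) abstract cycle `o₀σ₀…oₙ` with `oₙ = o₀`. -/
structure AbsCycle (G : MPG) where
  n : ℕ
  npos : 0 < n
  obs : ℕ → Set G.Q
  act : ℕ → G.A
  mem : ∀ i ≤ n, obs i ∈ G.Obs
  path : ∀ i < n, ∃ q ∈ obs i, ∃ q' ∈ obs (i + 1), G.delta q (act i) q'
  closed : obs n = obs 0

variable (G : MPG)

/-- A good abstract cycle. -/
def Good (c : AbsCycle G) : Prop :=
  ∃ fs : ℕ → G.FF,
    (∀ i ≤ c.n, G.Fsupp (fs i) = c.obs i) ∧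
    (∀ i < c.n, G.IsSucc (fs i) (c.act i) (fs (i + 1))) ∧
    (∀ i ≤ c.n, ∀ q ∈ G.Fsupp (fs i), fs i q ≠ some ⊤) ∧
    G.prec 0 (fs 0) (fs c.n)

/-- A bad abstract cycle. -/
def Bad (c : AbsCycle G) : Prop :=
  ∃ fs : ℕ → G.FF,
    (∀ i ≤ c.n, G.Fsupp (fs i) = c.obs i) ∧
    (∀ i < c.n, G.IsSucc (fs i) (c.act i) (fs (i + 1))) ∧
    (∃ q ∈ G.Fsupp (fs 0), fs 0 q ≠ some ⊤) ∧
    G.prec 1 (fs c.n) (fs 0)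

end MPG

namespace MPG

/-- A finite value on the support of a `σ`-successor of `f` is at most the value of `f` at any
`σ`-predecessor plus the weight of the transition. -/
lemma IsSucc.le_add_weight {G : MPG} {f f' : G.FF} {a : G.A} (h : G.IsSucc f a f')
    {q q' : G.Q} {x y : ℤ} (hx : f q = some (x : WithTop ℤ)) (hy : f' q' = some (y : WithTop ℤ))
    (hd : G.delta q a q') : y ≤ x + G.w q a q' := by
  have hq' : q' ∈ G.Fsupp f' := by simp [Fsupp, hy]
  rcases h.2.2 q' hq' with htop | ⟨m, hm, -, hmin⟩
  · rw [hy] at htop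
    exact absurd (Option.some.inj htop) (WithTop.coe_ne_top)
  · obtain rfl : (y : WithTop ℤ) = m := Option.some.inj (hy.symm.trans hm)
    exact_mod_cast hmin _ ⟨q, x, hx, hd, rfl⟩

/-- A value of `f` read as an integer, with `0` for `⊥` and `+∞`. -/
def intValue {G : MPG} (f : G.FF) (q : G.Q) : ℤ := ((f q).getD ⊤).untopD 0

lemma eq_some_intValue {G : MPG} {f : G.FF} {q : G.Q} (hq : q ∈ G.Fsupp f)
    (htop : f q ≠ some ⊤) : f q = some (intValue f q : WithTop ℤ) := by
  obtain ⟨v, hv⟩ := Option.ne_none_iff_exists'.mp hq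
  lift v to ℤ using fun h => htop (hv.trans (congrArg some h))
  simp [intValue, hv]

lemma prec.intValue_le {G : MPG} {f f' : G.FF} (h : G.prec 0 f f') {q : G.Q}
    (hq : q ∈ G.Fsupp f) (hf' : f' q ≠ some ⊤) : intValue f q ≤ intValue f' q := by
  obtain ⟨v, v', hv, hv', hle⟩ := h.2 q hq
  lift v' to ℤ using fun h => hf' (hv'.trans (congrArg some h))
  have hle : v ≤ v' := by simpa using hle
  lift v to ℤ using (hle.trans_lt (WithTop.coe_lt_top v')).ne
  simpa [intValue, hv, hv'] using hle

end MPG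

/-- every concrete cycle along `ρᵏ`, for a good abstract cycle `ρ`,
has non-negative weight. -/
theorem good_cycle_concrete_nonneg (G : MPG) (hG : G.LimitedObs)
    (c : MPG.AbsCycle G) (hgood : G.Good c)
    (k : ℕ) (hk : 1 ≤ k) (π : ℕ → G.Q)
    (hdelta : ∀ j < k * c.n, G.delta (π j) (c.act (j % c.n)) (π (j + 1)))
    (hmem : ∀ j ≤ k * c.n, π j ∈ c.obs (j % c.n))
    (hcyc : π (k * c.n) = π 0) :
    0 ≤ ∑ j ∈ Finset.range (k * c.n), G.w (π j) (c.act (j % c.n)) (π (j + 1)) := by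
  obtain ⟨fs, hsupp, hsucc, hfin, hprec⟩ := hgood
  have hval : ∀ i ≤ c.n, ∀ q ∈ c.obs i,
      fs i q = some (MPG.intValue (fs i) q : WithTop ℤ) := fun i hi q hq =>
    have hq := (hsupp i hi).symm ▸ hq
    MPG.eq_some_intValue hq (hfin i hi q hq)
  have hstep : ∀ j ∈ Finset.range (k * c.n),
      MPG.intValue (fs ((j + 1) % c.n)) (π (j + 1)) - MPG.intValue (fs (j % c.n)) (π j) ≤
        G.w (π j) (c.act (j % c.n)) (π (j + 1)) := by
    intro j hj
    rw [Finset.mem_range] at hj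
    have hlt : j % c.n < c.n := Nat.mod_lt _ c.npos
    have key : π (j + 1) ∈ c.obs (j % c.n + 1) →
        MPG.intValue (fs (j % c.n + 1)) (π (j + 1)) ≤
          MPG.intValue (fs (j % c.n)) (π j) + G.w (π j) (c.act (j % c.n)) (π (j + 1)) :=
      fun hmem' => (hsucc _ hlt).le_add_weight (hval _ hlt.le _ (hmem j hj.le))
        (hval _ hlt _ hmem') (hdelta j hj)
    have hnext := hmem (j + 1) hj
    rcases Nat.lt_or_eq_of_le (Nat.succ_le_of_lt hlt) with h | h
    · have hmod : (j + 1) % c.n = j % c.n + 1 := by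
        rw [← Nat.mod_add_mod, Nat.mod_eq_of_lt h]
      rw [hmod] at hnext ⊢
      linarith [key hnext]
    · have hwrap : j % c.n + 1 = c.n := h
      have hmod : (j + 1) % c.n = 0 := by
        rw [← Nat.mod_add_mod, hwrap, Nat.mod_self]
      rw [hmod] at hnext ⊢
      rw [hwrap, c.closed] at key
      have hq := (hsupp 0 (Nat.zero_le _)).symm ▸ hnext
      linarith [key hnext, hprec.intValue_le hq (hfin _ le_rfl _ (hprec.1 ▸ hq))]
  have hsum := Finset.sum_le_sum hstep
  rw [Finset.sum_range_sub (fun j => MPG.intValue (fs (j % c.n)) (π j)), hcyc] at hsum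
  simpa using hsum
end
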